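/- arXiv:1503.05930 — 8 statements merged into one kernel-verified Lean document; each statement's English description precedes it below -/
import Mathlib

section
/- Let c ≥ d ≥ 0 be integers. Then (c+d+1) times the number of lattice paths from (0,0) to (c,d) with steps (1,0) and (0,1), all of whose points (x,y) satisfy x ≥ y, equals (c+1−d)·C(c+d+1, d). In particular, for every n ≥ 0, (n+1) times the number of such paths from (0,0) to (n,n) equals C(2n, n), i.e. this number is the Catalan number C(2n,n)/(n+1). -/
/-- The set of lattice paths (as lists of their points) from `A` to `E` in `ℤ²`
with steps `(1,0)` and `(0,1)`, all of whose points satisfy the condition `C`. -/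
def SPaths (A E : ℤ × ℤ) (C : ℤ × ℤ → Prop) : Set (List (ℤ × ℤ)) :=
  {p | p.head? = some A ∧ p.getLast? = some E ∧
       List.Chain' (fun q q' => q' - q = ((1 : ℤ), (0 : ℤ)) ∨ q' - q = ((0 : ℤ), (1 : ℤ))) p ∧
       ∀ q ∈ p, C q}

/-- Binomial coefficient `C(n,k)` for integer arguments, `0` unless `0 ≤ k ≤ n`. -/
def ibinom (n k : ℤ) : ℤ :=
  if 0 ≤ k ∧ k ≤ n then (Nat.choose n.toNat k.toNat : ℤ) else 0

/-- Decomposition of a lattice path according to its last step. -/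
lemma mem_SPaths_iff {A E : ℤ × ℤ} {C : ℤ × ℤ → Prop} {p : List (ℤ × ℤ)} :
    p ∈ SPaths A E C ↔ C E ∧ ((p = [E] ∧ E = A) ∨
      ∃ q, q ∈ SPaths A (E - (1, 0)) C ∪ SPaths A (E - (0, 1)) C ∧ q ++ [E] = p) := by
  rcases List.eq_nil_or_concat p with rfl | ⟨q, b, rfl⟩
  · simp [SPaths]
  rcases List.eq_nil_or_concat q with rfl | ⟨r, a, rfl⟩
  · simp only [SPaths, Set.mem_union, Set.mem_ofPred_eq, List.concat_eq_append]
    constructor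
    · rintro ⟨h₁, h₂, -, h₄⟩
      simp_all
    · rintro ⟨h₁, ⟨h₂, rfl⟩ | ⟨q, hq, h⟩⟩
      · simpa [h₂] using ⟨List.isChain_singleton E, h₁⟩
      · cases q <;> simp_all
  · have key : ∀ x y : ℤ × ℤ, ∀ v : ℤ × ℤ, y - x = v ↔ x = y - v := fun x y v =>
      ⟨fun h => by rw [← h]; abel, fun h => by rw [h]; abel⟩
    simp only [SPaths, Set.mem_union, Set.mem_ofPred_eq, List.concat_eq_append, key]
    constructor
    · rintro ⟨h₁, h₂, h₃, h₄⟩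
      obtain rfl : b = E := by simpa using h₂
      refine ⟨h₄ b (by simp), Or.inr ⟨r ++ [a], ?_, rfl⟩⟩
      have h₅ := List.isChain_append.1 h₃
      have h₆ := h₅.2.2 a (by simp) b (by simp)
      have h₇ : (r ++ [a]).head? = some A := by cases r <;> simp_all
      have h₈ : ∀ q ∈ r ++ [a], C q := fun q hq => h₄ q (List.mem_append_left _ hq)
      rcases h₆ with h | h
      · exact Or.inl ⟨h₇, by simp [h], h₅.1, h₈⟩
      · exact Or.inr ⟨h₇, by simp [h], h₅.1, h₈⟩
    · rintro ⟨h₁, ⟨h₂, rfl⟩ | ⟨q, hq, h⟩⟩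
      · exact absurd (congrArg List.length h₂) (by simp)
      · obtain ⟨rfl, h'⟩ := List.append_inj' h rfl
        obtain rfl : E = b := by simpa using h'
        have h₆ : a = E - (1, 0) ∨ a = E - (0, 1) := by
          rcases hq with hq | hq
          · exact Or.inl (by simpa using hq.2.1)
          · exact Or.inr (by simpa using hq.2.1)
        have h₇ : (r ++ [a]).head? = some A := by
          rcases hq with hq | hq <;> exact hq.1
        have h₈ : ∀ q ∈ r ++ [a], C q := by
          rcases hq with hq | hq <;> exact hq.2.2.2
        refine ⟨by cases r <;> simp_all, by simp, List.isChain_append.2 ⟨?_, by simp, ?_⟩, ?_⟩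
        · rcases hq with hq | hq <;> exact hq.2.2.1
        · intro x hx y hy
          obtain rfl : a = x := by simpa using hx
          obtain rfl : E = y := by simpa using hy
          exact h₆
        · intro x hx
          rcases List.mem_append.1 hx with hx | hx
          · exact h₈ x hx
          · rw [List.mem_singleton.1 hx]; exact h₁

lemma SPaths_eq_empty_of_not {A E : ℤ × ℤ} {C : ℤ × ℤ → Prop} (h : ¬ C E) :
    SPaths A E C = ∅ :=
  Set.eq_empty_of_forall_notMem fun _ hp => h (mem_SPaths_iff.1 hp).1

lemma snd_le_of_mem_SPaths {A : ℤ × ℤ} {C : ℤ × ℤ → Prop} (p : List (ℤ × ℤ)) :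
    ∀ E, p ∈ SPaths A E C → A.2 ≤ E.2 := by
  induction p using List.reverseRecOn with
  | nil => intro E h; simp [SPaths] at h
  | append_singleton q b ih =>
    intro E h
    obtain ⟨-, ⟨-, rfl⟩ | ⟨r, hr, h⟩⟩ := mem_SPaths_iff.1 h
    · exact le_rfl
    · obtain ⟨rfl, -⟩ := List.append_inj' h rfl
      rcases hr with hr | hr
      · simpa using ih _ hr
      · have := ih _ hr
        simp only [Prod.snd_sub] at this
        omega

lemma SPaths_eq_empty_of_snd_lt {A E : ℤ × ℤ} {C : ℤ × ℤ → Prop} (h : E.2 < A.2) :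
    SPaths A E C = ∅ :=
  Set.eq_empty_of_forall_notMem fun p hp => h.not_ge (snd_le_of_mem_SPaths p E hp)

lemma encard_SPaths {A E : ℤ × ℤ} {C : ℤ × ℤ → Prop} (hC : C E) (hE : E ≠ A) :
    (SPaths A E C).encard =
      (SPaths A (E - (1, 0)) C).encard + (SPaths A (E - (0, 1)) C).encard := by
  have h : SPaths A E C =
      (· ++ [E]) '' (SPaths A (E - (1, 0)) C ∪ SPaths A (E - (0, 1)) C) := by
    ext p
    rw [mem_SPaths_iff]
    simp [hC, hE]
  rw [h, (List.append_left_injective [E]).encard_image, Set.encard_union_eq]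
  refine Set.disjoint_left.2 fun p hp hp' => ?_
  have h₁ := hp.2.1.symm.trans hp'.2.1
  simp at h₁

/-- The ballot numbers count the lattice paths staying weakly below the diagonal. -/
lemma exists_encard_SPaths_eq (c d : ℕ) (h : d ≤ c + 1) :
    ∃ m : ℕ, (SPaths (0, 0) ((c : ℤ), (d : ℤ)) (fun q => q.2 ≤ q.1)).encard = m ∧
      (m : ℤ) = (c + d).choose c - (c + d).choose (c + 1) := by
  induction c generalizing d with
  | zero =>
    rcases Nat.le_one_iff_eq_zero_or_eq_one.1 h with rfl | rfl
    · refine ⟨1, ?_, by simp⟩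
      have : SPaths (0, 0) (((0 : ℕ) : ℤ), ((0 : ℕ) : ℤ)) (fun q => q.2 ≤ q.1) = {[(0, 0)]} := by
        ext p
        rw [mem_SPaths_iff, SPaths_eq_empty_of_not (by simp), SPaths_eq_empty_of_snd_lt (by simp)]
        simp
      rw [this]; simp
    · exact ⟨0, by rw [SPaths_eq_empty_of_not (by simp)]; simp, by simp⟩
  | succ c ihc =>
    induction d with
    | zero =>
      obtain ⟨m, hm, hm'⟩ := ihc 0 (by omega)
      refine ⟨m, ?_, by simpa using hm'⟩
      rw [encard_SPaths (by simp; omega) (by simp; omega),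
        SPaths_eq_empty_of_snd_lt (E := _ - (0, 1)) (by simp)]
      simpa using hm
    | succ d ihd =>
      rcases h.lt_or_eq with h | h
      · obtain ⟨m, hm, hm'⟩ := ihc (d + 1) (by omega)
        obtain ⟨k, hk, hk'⟩ := ihd (by omega)
        refine ⟨m + k, ?_, ?_⟩
        · rw [encard_SPaths (by simp; omega) (by simp; omega)]
          push_cast at hm hk ⊢
          simp [hm, hk]
        · have e₁ : c + 1 + (d + 1) = (c + d + 1) + 1 := by omega
          have e₂ : c + (d + 1) = c + d + 1 := by omega
          have e₃ : c + 1 + d = c + d + 1 := by omega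
          rw [e₂] at hm'
          rw [e₃] at hk'
          rw [e₁, Nat.choose_succ_succ _ c, Nat.choose_succ_succ _ (c + 1)]
          push_cast
          linarith
      · obtain rfl : d = c + 1 := by omega
        refine ⟨0, ?_, ?_⟩
        · rw [SPaths_eq_empty_of_not (by simp)]; simp
        · rw [Nat.choose_symm_of_eq_add (show c + 1 + (c + 1 + 1) = (c + 1) + (c + 1 + 1) from rfl)]
          simp

lemma ncard_SPaths_eq (c d : ℕ) (h : d ≤ c + 1) :
    ((SPaths (0, 0) ((c : ℤ), (d : ℤ)) (fun q => q.2 ≤ q.1)).ncard : ℤ) =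
      (c + d).choose c - (c + d).choose (c + 1) := by
  obtain ⟨m, hm, hm'⟩ := exists_encard_SPaths_eq c d h
  rw [← hm', Set.ncard, hm]
  simp

lemma ibinom_natCast (n k : ℕ) : ibinom n k = n.choose k := by
  unfold ibinom
  split_ifs with h
  · simp
  · rw [Nat.choose_eq_zero_of_lt (by omega)]; simp

theorem statement1 (c d : ℤ) (hd : 0 ≤ d) (hcd : d ≤ c) :
    (c + d + 1) * ((SPaths (0, 0) (c, d) (fun q => q.2 ≤ q.1)).ncard : ℤ)
        = (c + 1 - d) * ibinom (c + d + 1) d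
    ∧ ∀ n : ℤ, 0 ≤ n →
        (n + 1) * ((SPaths (0, 0) (n, n) (fun q => q.2 ≤ q.1)).ncard : ℤ)
          = ibinom (2 * n) n := by
  constructor
  · lift d to ℕ using hd
    lift c to ℕ using (by omega)
    have e : ibinom (c + d + 1) d = (c + d + 1).choose (c + 1) := by
      rw [← Nat.choose_symm_of_eq_add (show c + d + 1 = d + (c + 1) by omega)]
      exact_mod_cast ibinom_natCast (c + d + 1) d
    rw [e, ncard_SPaths_eq c d (by omega)]
    have h₁ := Nat.add_one_mul_choose_eq (c + d) c
    have h₂ := Nat.choose_succ_succ (c + d) c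
    zify at h₁ h₂
    linear_combination 2 * h₁ + ((c : ℤ) + d + 1) * h₂
  · intro n hn
    lift n to ℕ using hn
    have e : ibinom (2 * n) n = (2 * n).choose n := mod_cast ibinom_natCast (2 * n) n
    rw [e, ncard_SPaths_eq n n (by omega), ← two_mul]
    have h := Nat.choose_succ_right_eq (2 * n) n
    rw [show 2 * n - n = n by omega] at h
    zify at h
    linear_combination -h
end

section
/- Let r and s be relatively prime positive integers. Then (r+s) times the number of lattice paths from (0,0) to (r,s) with steps (1,0) and (0,1), all of whose points (x,y) satisfy s·x ≥ r·y, equals C(r+s, r). -/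
open Finset

/-- The number of `j < m` whose residue class modulo `n` lies in `A`. -/
def residueCount {n : ℕ} (A : Finset (ZMod n)) (m : ℕ) : ℕ :=
  Nat.count (fun j : ℕ => (j : ZMod n) ∈ A) m

/-- The translate of `A` by `-k`. -/
def residueShift {n : ℕ} (k : ℕ) (A : Finset (ZMod n)) : Finset (ZMod n) :=
  A.map (Equiv.subRight (k : ZMod n)).toEmbedding

/-- Every initial segment of `0, 1, …, n - 1` contains at least its proportional share of `A`. -/
def IsDominating {n : ℕ} (A : Finset (ZMod n)) : Prop :=
  ∀ m ≤ n, #A * m ≤ n * residueCount A m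

theorem residueCount_zero {n : ℕ} (A : Finset (ZMod n)) : residueCount A 0 = 0 :=
  Nat.count_zero _

theorem residueCount_succ {n : ℕ} (A : Finset (ZMod n)) (m : ℕ) :
    residueCount A (m + 1) = residueCount A m + if (m : ZMod n) ∈ A then 1 else 0 :=
  Nat.count_succ _ _

theorem residueCount_self {n : ℕ} [NeZero n] (A : Finset (ZMod n)) : residueCount A n = #A := by
  rw [residueCount, Nat.count_eq_card_filter_range]
  refine card_nbij' (fun j => (j : ZMod n)) ZMod.val ?_ ?_ ?_ ?_
  · intro j hj
    simpa using (mem_filter.mp hj).2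
  · intro a ha
    simpa [ZMod.val_lt] using ha
  · intro j hj
    exact ZMod.val_cast_of_lt (mem_range.mp (mem_filter.mp hj).1)
  · intro a _
    simp

theorem card_residueShift {n : ℕ} (k : ℕ) (A : Finset (ZMod n)) : #(residueShift k A) = #A :=
  card_map _

theorem mem_residueShift {n k : ℕ} {A : Finset (ZMod n)} {x : ZMod n} :
    x ∈ residueShift k A ↔ (k : ZMod n) + x ∈ A := by
  simp [residueShift, add_comm]

theorem residueCount_add {n : ℕ} (A : Finset (ZMod n)) (k m : ℕ) :
    residueCount A (k + m) = residueCount A k + residueCount (residueShift k A) m := by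
  simp [residueCount, Nat.count_add, mem_residueShift]

theorem residueCount_add_self {n : ℕ} [NeZero n] (A : Finset (ZMod n)) (k : ℕ) :
    residueCount A (k + n) = residueCount A k + #A := by
  rw [residueCount_add, residueCount_self, card_residueShift]

theorem isDominating_residueShift_iff {n : ℕ} (A : Finset (ZMod n)) (k : ℕ) :
    IsDominating (residueShift k A) ↔
      ∀ m ≤ n, (n * residueCount A k - #A * k : ℤ) ≤
        n * residueCount A (k + m) - #A * (k + m : ℕ) := by
  refine forall₂_congr fun m _ => ?_
  rw [card_residueShift, residueCount_add]
  zify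
  constructor <;> intro h <;> linarith

theorem exists_isDominating_residueShift {n : ℕ} [NeZero n] (A : Finset (ZMod n)) :
    ∃ k < n, IsDominating (residueShift k A) := by
  obtain ⟨k, hk, hmin⟩ := exists_min_image (range n)
    (fun k => (n * residueCount A k - #A * k : ℤ)) ⟨0, by simp [NeZero.pos n]⟩
  refine ⟨k, mem_range.mp hk, (isDominating_residueShift_iff A k).mpr fun m hm => ?_⟩
  rw [mem_range] at hk
  by_cases h : k + m < n
  · exact hmin _ (mem_range.mpr h)
  · obtain ⟨j, hj⟩ : ∃ j, k + m = j + n := ⟨k + m - n, by omega⟩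
    have := hmin j (mem_range.mpr (by omega))
    rw [hj, residueCount_add_self]
    push_cast
    linarith

theorem eq_of_isDominating_residueShift_of_le {n : ℕ} [NeZero n] {A : Finset (ZMod n)}
    (hA : Nat.Coprime (#A) n) {k l : ℕ} (hkl : k ≤ l) (hl : l < n)
    (hAk : IsDominating (residueShift k A)) (hAl : IsDominating (residueShift l A)) : k = l := by
  rw [isDominating_residueShift_iff] at hAk hAl
  have h₁ := hAk (l - k) (by omega)
  have h₂ := hAl (k + n - l) (by omega)
  rw [show k + (l - k) = l by omega] at h₁
  rw [show l + (k + n - l) = k + n by omega, residueCount_add_self] at h₂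
  push_cast at h₂
  have h : (#A * (l - k) : ℤ) = n * (residueCount A l - residueCount A k) := by linarith
  have hdvd : (n : ℤ) ∣ l - k :=
    (Nat.isCoprime_iff_coprime.mpr hA.symm).dvd_of_dvd_mul_left ⟨_, h⟩
  have := Int.eq_zero_of_dvd_of_nonneg_of_lt (by omega) (by omega) hdvd
  omega

theorem existsUnique_isDominating_residueShift {n : ℕ} [NeZero n] {A : Finset (ZMod n)}
    (hA : Nat.Coprime (#A) n) : ∃! k, k < n ∧ IsDominating (residueShift k A) := by
  obtain ⟨k, hk, hAk⟩ := exists_isDominating_residueShift A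
  refine ⟨k, ⟨hk, hAk⟩, fun l ⟨hl, hAl⟩ => ?_⟩
  rcases le_total k l with h | h
  · exact (eq_of_isDominating_residueShift_of_le hA h hl hAk hAl).symm
  · exact eq_of_isDominating_residueShift_of_le hA h hk hAl hAk

open Classical in
theorem mul_card_isDominating {n c : ℕ} [NeZero n] (hc : Nat.Coprime c n) :
    n * #{A ∈ powersetCard c (univ : Finset (ZMod n)) | IsDominating A} = n.choose c := by
  set P := powersetCard c (univ : Finset (ZMod n))
  have key := sum_card_bipartiteAbove_eq_sum_card_bipartiteBelow
    (s := P) (t := range n) (fun A k => IsDominating (residueShift k A))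
  have hleft : ∀ A ∈ P, #((range n).bipartiteAbove (fun A k => IsDominating (residueShift k A)) A)
      = 1 := by
    intro A hA
    have hA' : Nat.Coprime (#A) n := by rwa [(mem_powersetCard.mp hA).2]
    obtain ⟨k, hk, huniq⟩ := existsUnique_isDominating_residueShift hA'
    rw [card_eq_one]
    refine ⟨k, ext fun l => ?_⟩
    simp only [mem_bipartiteAbove, mem_range, mem_singleton]
    exact ⟨huniq l, fun h => h ▸ hk⟩
  have hright : ∀ k ∈ range n, #(P.bipartiteBelow (fun A k => IsDominating (residueShift k A)) k)
      = #{A ∈ P | IsDominating A} := by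
    intro k _
    refine card_bij (fun A _ => residueShift k A) ?_ ?_ ?_
    · intro A hA
      simpa [P, mem_bipartiteBelow, mem_powersetCard, card_residueShift] using hA
    · intro A _ B _ h
      exact map_injective _ h
    · intro B hB
      have hB' : residueShift k (B.map (Equiv.addRight (k : ZMod n)).toEmbedding) = B := by
        ext x
        simp [mem_residueShift, add_comm]
      refine ⟨B.map (Equiv.addRight (k : ZMod n)).toEmbedding, ?_, hB'⟩
      rw [mem_bipartiteBelow, hB']
      simpa [P, mem_powersetCard] using hB
  rw [sum_congr rfl hleft, sum_congr rfl hright] at key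
  simpa [P, card_powersetCard, ZMod.card] using key.symm

/-- The lattice path from the origin whose `j`-th step is `(1, 0)` if `j ∈ A` and `(0, 1)`
otherwise, for `j < n`. -/
def pathOf {n : ℕ} (A : Finset (ZMod n)) : List (ℤ × ℤ) :=
  (List.range (n + 1)).map fun j => ((residueCount A j : ℤ), (j : ℤ) - residueCount A j)

theorem pathOf_injective {n : ℕ} [NeZero n] :
    Function.Injective (pathOf : Finset (ZMod n) → List (ℤ × ℤ)) := by
  intro A B h
  have hcount : ∀ j ≤ n, residueCount A j = residueCount B j := by
    intro j hj
    have := List.map_inj_left.mp h j (by simp; omega)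
    simpa using congrArg Prod.fst this
  ext x
  have h₁ := hcount x.val x.val_lt.le
  have h₂ := hcount (x.val + 1) x.val_lt
  rw [residueCount_succ, residueCount_succ, h₁, ZMod.natCast_rightInverse x] at h₂
  split_ifs at h₂ <;> simp_all

theorem pathOf_mem_sPaths_iff {n : ℕ} [NeZero n] (A : Finset (ZMod n)) (E : ℤ × ℤ)
    (C : ℤ × ℤ → Prop) :
    pathOf A ∈ SPaths (0, 0) E C ↔ ((#A : ℤ), (n : ℤ) - #A) = E ∧
      ∀ j ≤ n, C ((residueCount A j : ℤ), (j : ℤ) - residueCount A j) := by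
  have hchain : (pathOf A).IsChain
      (fun q q' => q' - q = ((1 : ℤ), (0 : ℤ)) ∨ q' - q = ((0 : ℤ), (1 : ℤ))) := by
    rw [List.isChain_iff_getElem]
    intro i hi
    simp only [pathOf, List.getElem_map, List.getElem_range, residueCount_succ]
    split_ifs
    · left; ext <;> simp
    · right; ext <;> simp
  have hhead : (pathOf A).head? = some (0, 0) := by
    simp [pathOf, List.head?_range, residueCount_zero]
  have hlast : (pathOf A).getLast? = some ((#A : ℤ), (n : ℤ) - #A) := by
    simp [pathOf, List.getLast?_range, residueCount_self]
  have hmem : (∀ q ∈ pathOf A, C q) ↔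
      ∀ j ≤ n, C ((residueCount A j : ℤ), (j : ℤ) - residueCount A j) := by
    simp [pathOf]
  constructor
  · rintro ⟨-, h, -, hC⟩
    exact ⟨Option.some_injective _ (hlast.symm.trans h), hmem.mp hC⟩
  · rintro ⟨h, hC⟩
    exact ⟨hhead, hlast.trans (congrArg some h), hchain, hmem.mpr hC⟩

theorem mem_range_pathOf {n : ℕ} [NeZero n] {E : ℤ × ℤ} (hE : E.1 + E.2 = n)
    {C : ℤ × ℤ → Prop} {p : List (ℤ × ℤ)} (hp : p ∈ SPaths (0, 0) E C) :
    ∃ A : Finset (ZMod n), pathOf A = p := by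
  obtain ⟨hhead, hlast, hchain, -⟩ := hp
  replace hchain := fun i hi => List.isChain_iff_getElem.mp hchain i hi
  have hpos : 0 < p.length := by
    rcases p with _ | _ <;> simp at hhead ⊢
  have hzero : p[0] = (0, 0) := by
    simpa [List.head?_eq_getElem?, hpos] using hhead
  have hsum : ∀ i (hi : i < p.length), p[i].1 + p[i].2 = i := by
    intro i
    induction i with
    | zero => intro hi; simp [hzero]
    | succ i ih =>
      intro hi
      have := ih (by omega)
      rcases hchain i hi with h | h <;> simp only [Prod.ext_iff, Prod.fst_sub, Prod.snd_sub] at h <;>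
        (push_cast; omega)
  have hlength : p.length = n + 1 := by
    have hlt : p.length - 1 < p.length := by omega
    have hE' : p[p.length - 1] = E := by
      simpa [List.getLast?_eq_getElem?, hpos] using hlast
    have := hsum _ hlt
    rw [hE', hE] at this
    omega
  let A : Finset (ZMod n) :=
    {x | ∃ h : x.val + 1 < p.length, p[x.val + 1] - p[x.val] = ((1 : ℤ), (0 : ℤ))}
  have hA : ∀ i (hi : i < p.length), (residueCount A i : ℤ) = p[i].1 := by
    intro i
    induction i with
    | zero => intro hi; simp [hzero, residueCount_zero]
    | succ i ih =>
      intro hi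
      have hi' := ih (by omega)
      have hval : (i : ZMod n).val = i := ZMod.val_cast_of_lt (by omega)
      have hiA : (i : ZMod n) ∈ A ↔ p[i + 1] - p[i] = ((1 : ℤ), (0 : ℤ)) := by
        simp only [A, mem_filter, mem_univ, true_and, hval, hi, exists_true_left]
      rw [residueCount_succ]
      rcases hchain i hi with h | h
      · rw [if_pos (hiA.mpr h)]
        simp only [Prod.ext_iff, Prod.fst_sub] at h
        push_cast
        omega
      · rw [if_neg (by simp [hiA, h])]
        simp only [Prod.ext_iff, Prod.fst_sub] at h
        push_cast
        omega
  refine ⟨A, List.ext_getElem (by simp [pathOf, hlength]) fun i _ hi => ?_⟩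
  have h₁ := hA i hi
  have h₂ := hsum i hi
  simp only [pathOf, List.getElem_map, List.getElem_range]
  ext <;> simp <;> omega

theorem statement4 (r s : ℕ) (hr : 0 < r) (hs : 0 < s) (hrs : Nat.Coprime r s) :
    (r + s) * (SPaths (0, 0) ((r : ℤ), (s : ℤ)) (fun q => (r : ℤ) * q.2 ≤ (s : ℤ) * q.1)).ncard
      = Nat.choose (r + s) r := by
  have : NeZero (r + s) := ⟨by omega⟩
  classical
  have hpaths : SPaths (0, 0) ((r : ℤ), (s : ℤ)) (fun q => (r : ℤ) * q.2 ≤ (s : ℤ) * q.1) =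
      Set.image pathOf (SetLike.coe
        (filter IsDominating (powersetCard r (univ : Finset (ZMod (r + s)))))) := by
    have hiff : ∀ A : Finset (ZMod (r + s)),
        pathOf A ∈ SPaths (0, 0) ((r : ℤ), (s : ℤ)) (fun q => (r : ℤ) * q.2 ≤ (s : ℤ) * q.1) ↔
          #A = r ∧ IsDominating A := by
      intro A
      rw [pathOf_mem_sPaths_iff, Prod.ext_iff]
      have hcard : ((#A : ℤ) = r ∧ ((r + s : ℕ) : ℤ) - #A = s) ↔ #A = r := by omega
      simp only [hcard]
      refine and_congr_right fun hA => forall₂_congr fun m _ => ?_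
      rw [hA]
      zify
      constructor <;> intro h <;> linarith
    ext p
    simp only [Set.mem_image, mem_coe, mem_filter, mem_powersetCard_univ]
    constructor
    · intro hp
      obtain ⟨A, rfl⟩ := mem_range_pathOf (n := r + s) (by simp) hp
      exact ⟨A, (hiff A).mp hp, rfl⟩
    · rintro ⟨A, hA, rfl⟩
      exact (hiff A).mpr hA
  rw [hpaths, Set.ncard_image_of_injective _ pathOf_injective, Set.ncard_coe_finset]
  convert mul_card_isDominating (n := r + s) (c := r) (by simpa using hrs)
end

section
/- (Cycle lemma of Dvoretzky and Motzkin.) Let μ be a non-negative integer, and let p₁p₂⋯p_{m+n} be a sequence consisting of m letters equal to 1 and n letters equal to 2, with m ≥ μn. Then the number of indices i ∈ {1, …, m+n} such that the cyclic rotation p_i p_{i+1} ⋯ p_{m+n} p_1 ⋯ p_{i−1} has the property that, for every j = 1, 2, …, m+n, the first j letters of the rotated sequence contain strictly more letters 1 than μ times their number of letters 2, equals exactly m − μn. -/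
open scoped Classical

/-- If `S` climbs by at most `1` at each step and gains `D ≥ 0` over each period of length `N`,
then each period contains exactly `D` indices after which `S` stays strictly above its
current value. -/
theorem card_filter_lt_add_of_periodic_gain (S : ℕ → ℤ) (N D : ℕ) (hN : 0 < N)
    (hper : ∀ i, S (i + N) = S i + D) (hstep : ∀ i, S (i + 1) ≤ S i + 1) :
    ((Finset.range N).filter (fun i => ∀ j ∈ Finset.Icc 1 N, S i < S (i + j))).card = D := by
  have hmin : ∀ i, ∃ k, i ≤ k ∧ ∀ l, i ≤ l → S k ≤ S l := by
    intro i
    obtain ⟨k, hk, hkmin⟩ := Finset.exists_min_image (Finset.Ico i (i + N)) S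
      ⟨i, by simp [hN]⟩
    refine ⟨k, (Finset.mem_Ico.mp hk).1, fun l => ?_⟩
    induction l using Nat.strong_induction_on with
    | _ l ih =>
      intro hl
      by_cases hlN : l < i + N
      · exact hkmin l (Finset.mem_Ico.mpr ⟨hl, hlN⟩)
      · have h₁ := ih (l - N) (by omega) (by omega)
        have h₂ := hper (l - N)
        rw [Nat.sub_add_cancel (by omega)] at h₂
        omega
  choose f hf hfmin using hmin
  have hjump : ∀ i, (if ∀ j ∈ Finset.Icc 1 N, S i < S (i + j) then (1 : ℤ) else 0)
      = S (f (i + 1)) - S (f i) := by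
    intro i
    have hmono : S (f i) ≤ S (f (i + 1)) := hfmin i _ (by have := hf (i + 1); omega)
    have hle : S (f i) ≤ S i := hfmin i i le_rfl
    have hcase : S (f i) = S i ∨ S (f (i + 1)) ≤ S (f i) := by
      rcases (hf i).eq_or_lt with h | h
      · exact Or.inl (by rw [← h])
      · exact Or.inr (hfmin (i + 1) _ h)
    have hnext : S (f (i + 1)) ≤ S (i + 1) := hfmin (i + 1) _ le_rfl
    have hs := hstep i
    split_ifs with hgood
    · have hlt : S i < S (f (i + 1)) := by
        have key : ∀ l, i + 1 ≤ l → S i < S l := by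
          intro l
          induction l using Nat.strong_induction_on with
          | _ l ih =>
            intro hl
            by_cases hlN : l ≤ i + N
            · have := hgood (l - i) (Finset.mem_Icc.mpr ⟨by omega, by omega⟩)
              rwa [Nat.add_sub_cancel' (by omega)] at this
            · have h₁ := ih (l - N) (by omega) (by omega)
              have h₂ := hper (l - N)
              rw [Nat.sub_add_cancel (by omega)] at h₂
              omega
        exact key _ (hf (i + 1))
      omega
    · push Not at hgood
      obtain ⟨j, hj, hSj⟩ := hgood
      have := hfmin (i + 1) (i + j) (by have := (Finset.mem_Icc.mp hj).1; omega)
      omega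
  have hshift : S (f N) = S (f 0) + D := by
    apply le_antisymm
    · rw [← hper]
      exact hfmin N _ (by omega)
    · have h₁ := hfmin 0 (f N - N) (by omega)
      have h₂ := hper (f N - N)
      rw [Nat.sub_add_cancel (hf N)] at h₂
      omega
  have hsum : (((Finset.range N).filter
      (fun i => ∀ j ∈ Finset.Icc 1 N, S i < S (i + j))).card : ℤ) = D := by
    rw [Finset.card_filter]
    push_cast
    trans ∑ i ∈ Finset.range N, (S (f (i + 1)) - S (f i))
    · refine Finset.sum_congr rfl fun i _ => ?_
      rw [← hjump i]
      congr
    · rw [Finset.sum_range_sub (fun i => S (f i)), hshift]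
      ring
  exact_mod_cast hsum

/-- Summing weight `1` over the letters `1` and weight `-μ` over the letters `2` counts the
former minus `μ` times the latter. -/
theorem sum_letter_weights (μ : ℕ) (q : ℕ → ℕ) (s : Finset ℕ)
    (hq : ∀ t ∈ s, q t = 1 ∨ q t = 2) :
    ∑ t ∈ s, (if q t = 1 then (1 : ℤ) else -μ)
      = (s.filter (fun t => q t = 1)).card - μ * (s.filter (fun t => q t = 2)).card := by
  rw [Finset.card_filter, Finset.card_filter]
  push_cast
  rw [Finset.mul_sum, ← Finset.sum_sub_distrib]
  refine Finset.sum_congr rfl fun t ht => ?_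
  rcases hq t ht with h | h <;> simp [h]

/-- **Cycle lemma of Dvoretzky and Motzkin.** For a sequence of `m` letters `1` and `n`
letters `2` with `m ≥ μn`, exactly `m − μn` cyclic rotations have the property that every
prefix contains strictly more `1`'s than `μ` times its number of `2`'s. -/
theorem statement7 (μ m n : ℕ) (p : ℕ → ℕ)
    (hval : ∀ i < m + n, p i = 1 ∨ p i = 2)
    (hones : ((Finset.range (m + n)).filter (fun i => p i = 1)).card = m)
    (hmn : μ * n ≤ m) :
    ((Finset.range (m + n)).filter (fun i =>
        ∀ j ∈ Finset.Icc 1 (m + n),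
          μ * ((Finset.range j).filter (fun t => p ((i + t) % (m + n)) = 2)).card
            < ((Finset.range j).filter (fun t => p ((i + t) % (m + n)) = 1)).card)).card
      = m - μ * n := by
  rcases Nat.eq_zero_or_pos (m + n) with h0 | hN
  · obtain ⟨rfl, rfl⟩ : m = 0 ∧ n = 0 := by omega
    simp
  set a : ℕ → ℤ := fun t => if p (t % (m + n)) = 1 then 1 else -μ with ha
  set S : ℕ → ℤ := fun k => ∑ t ∈ Finset.range k, a t with hS
  have hletter : ∀ t, p (t % (m + n)) = 1 ∨ p (t % (m + n)) = 2 :=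
    fun t => hval _ (Nat.mod_lt _ hN)
  have hprefix : ∀ i j, S (i + j) = S i
      + (((Finset.range j).filter (fun t => p ((i + t) % (m + n)) = 1)).card
        - μ * ((Finset.range j).filter (fun t => p ((i + t) % (m + n)) = 2)).card) := by
    intro i j
    rw [← sum_letter_weights μ (fun t => p ((i + t) % (m + n))) _ fun t _ => hletter _]
    exact Finset.sum_range_add _ _ _
  have htwos : ((Finset.range (m + n)).filter (fun i => p i = 2)).card = n := by
    have hsplit := Finset.card_filter_add_card_filter_not (s := Finset.range (m + n))
      (fun i => p i = 1)
    have hcongr : (Finset.range (m + n)).filter (fun i => ¬ p i = 1)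
        = (Finset.range (m + n)).filter (fun i => p i = 2) :=
      Finset.filter_congr fun i hi => by
        rcases hval i (Finset.mem_range.mp hi) with h | h <;> simp [h]
    rw [hcongr, hones, Finset.card_range] at hsplit
    omega
  have htotal : S (m + n) = (m - μ * n : ℕ) := by
    have hmod : S (m + n)
        = ∑ t ∈ Finset.range (m + n), if p t = 1 then (1 : ℤ) else -μ :=
      Finset.sum_congr rfl fun t ht => by
        simp only [ha, Nat.mod_eq_of_lt (Finset.mem_range.mp ht)]
    rw [hmod, sum_letter_weights μ p _ fun t ht => hval t (Finset.mem_range.mp ht),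
      hones, htwos]
    push_cast [hmn]
    ring
  have hsucc : ∀ i, S (i + 1) = S i + a i := fun i => Finset.sum_range_succ _ _
  have hper : ∀ i, S (i + (m + n)) = S i + (m - μ * n : ℕ) := by
    intro i
    induction i with
    | zero => simpa [hS] using htotal
    | succ i ih =>
      have haper : a (i + (m + n)) = a i := by simp only [ha, Nat.add_mod_right]
      rw [Nat.add_right_comm, hsucc, hsucc, ih, haper]
      ring
  have hstep : ∀ i, S (i + 1) ≤ S i + 1 := by
    intro i
    rw [hsucc]
    simp only [ha]
    split_ifs <;> omega
  rw [← card_filter_lt_add_of_periodic_gain S (m + n) (m - μ * n) hN hper hstep]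
  refine congrArg Finset.card (Finset.ext fun i => ?_)
  simp only [Finset.mem_filter]
  refine and_congr_right fun _ => forall₂_congr fun j _ => ?_
  rw [hprefix i j, lt_add_iff_pos_right, sub_pos]
  exact_mod_cast Iff.rfl
end

section
/- Let n ≥ 1, and let a = (a₁, …, a_n) and b = (b₁, …, b_n) be integer sequences with a₁ ≤ a₂ ≤ ⋯ ≤ a_n, b₁ ≤ b₂ ≤ ⋯ ≤ b_n, and a_i ≥ b_i for all i. The number of lattice paths from (0, b₁) to (n, a_n) with steps (1,0) and (0,1) such that, for every i = 1, …, n, the y-coordinate at which the i-th horizontal step occurs lies between b_i and a_i, equals the determinant det_{1≤i,j≤n}( C(a_i − b_j + 1, j − i + 1) ). -/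
/-- Lattice paths from `(0, b 1)` to `(n, a n)` with steps `(1,0)` and `(0,1)` such that
the `i`-th horizontal step (the one ending at abscissa `i`) occurs at a height between
`b i` and `a i`. -/
def BoundedPaths (n : ℕ) (a b : ℤ → ℤ) : Set (List (ℤ × ℤ)) :=
  {p | p.head? = some (0, b 1) ∧ p.getLast? = some ((n : ℤ), a n) ∧
       List.Chain' (fun q q' =>
         (q' - q = ((1 : ℤ), (0 : ℤ)) ∨ q' - q = ((0 : ℤ), (1 : ℤ))) ∧
         (q' - q = ((1 : ℤ), (0 : ℤ)) → b q'.1 ≤ q.2 ∧ q.2 ≤ a q'.1)) p}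

theorem ibinom_natCast_s9 (m k : ℕ) : ibinom m k = (m.choose k : ℤ) := by
  unfold ibinom
  split_ifs with h
  · simp
  · rw [Nat.choose_eq_zero_of_lt (by omega), Nat.cast_zero]

theorem ibinom_of_lt {m k : ℤ} (h : m < k) : ibinom m k = 0 :=
  if_neg (by omega)

theorem ibinom_of_neg {m k : ℤ} (h : k < 0) : ibinom m k = 0 :=
  if_neg (by omega)

theorem ibinom_zero_right {m : ℤ} (h : 0 ≤ m) : ibinom m 0 = 1 := by
  lift m to ℕ using h
  simpa using ibinom_natCast_s9 m 0

theorem ibinom_succ_succ {m : ℤ} (hm : 0 ≤ m) (r : ℕ) :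
    ibinom (m + 1) (r + 1) = ibinom m r + ibinom m (r + 1) := by
  lift m to ℕ using hm
  have h := ibinom_natCast_s9 (m + 1) (r + 1)
  have h' := ibinom_natCast_s9 m (r + 1)
  push_cast at h h'
  rw [h, h', ibinom_natCast_s9, Nat.choose_succ_succ]
  push_cast
  rfl

theorem Int.Icc_succ_right {l u : ℤ} (h : l ≤ u + 1) :
    Finset.Icc l (u + 1) = insert (u + 1) (Finset.Icc l u) := by
  ext y
  simp only [Finset.mem_insert, Finset.mem_Icc]
  omega

theorem sum_mul_ibinom_by_parts (F : ℤ → ℤ) (l u : ℤ) (r : ℕ) :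
    ∑ y ∈ Finset.Icc l u, F y * ibinom (y - l) r
      = F u * ibinom (u - l + 1) (r + 1)
        - ∑ y ∈ Finset.Icc l u, (F y - F (y - 1)) * ibinom (y - l) (r + 1) := by
  rcases lt_or_ge u l with h | h
  · rw [Finset.Icc_eq_empty (by omega), ibinom_of_lt (by omega)]
    simp
  · replace h : l - 1 ≤ u := by omega
    induction u, h using Int.leInduction with
    | base =>
      rw [Finset.Icc_eq_empty (by omega), ibinom_of_lt (by omega)]
      simp
    | succ u hu ih =>
      have hnot : u + 1 ∉ Finset.Icc l u := by simp
      rw [Int.Icc_succ_right (by omega), Finset.sum_insert hnot, Finset.sum_insert hnot, ih,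
        ibinom_succ_succ (m := u + 1 - l) (by omega), add_sub_cancel_right,
        show u - l + 1 = u + 1 - l by ring]
      ring

/-- The number of sequences `h 0 ≤ h 1 ≤ ⋯ ≤ h (k - 1) ≤ x` with `β i ≤ h i ≤ α i` for all `i`. -/
noncomputable def boundedSeqCount (α β : ℕ → ℤ) : ℕ → ℤ → ℕ
  | 0, _ => 1
  | k + 1, x => ∑ y ∈ Finset.Icc (β k) (min x (α k)), boundedSeqCount α β k y

theorem boundedSeqCount_succ_of_ge (α β : ℕ → ℤ) (k : ℕ) {x : ℤ} (hx : α k ≤ x) :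
    boundedSeqCount α β (k + 1) x = ∑ y ∈ Finset.Icc (β k) (α k), boundedSeqCount α β k y := by
  rw [boundedSeqCount, min_eq_right hx]

theorem boundedSeqCount_succ_of_lt (α β : ℕ → ℤ) (k : ℕ) {x : ℤ} (hx : x < β k) :
    boundedSeqCount α β (k + 1) x = 0 := by
  rw [boundedSeqCount, Finset.Icc_eq_empty (by omega), Finset.sum_empty]

theorem boundedSeqCount_succ (α β : ℕ → ℤ) (k : ℕ) (x : ℤ) :
    boundedSeqCount α β (k + 1) (x + 1) = boundedSeqCount α β (k + 1) x +
      if β k ≤ x + 1 ∧ x + 1 ≤ α k then boundedSeqCount α β k (x + 1) else 0 := by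
  split_ifs with h
  · rw [boundedSeqCount, boundedSeqCount, min_eq_left h.2, min_eq_left (by omega),
      Int.Icc_succ_right h.1, Finset.sum_insert (by simp), add_comm]
  · rw [boundedSeqCount, boundedSeqCount, add_zero]
    congr 1
    ext y
    simp only [Finset.mem_Icc]
    omega

theorem sum_boundedSeqCount_mul_ibinom {n : ℕ} {α β : ℕ → ℤ}
    (hα : ∀ i, i + 1 < n → α i ≤ α (i + 1)) (hβ : ∀ i j, i ≤ j → j < n → β i ≤ β j)
    {j : ℕ} (hj : j < n) {k : ℕ} (hk : k ≤ j) :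
    ∑ i ∈ Finset.range (k + 1), (-1) ^ i * (boundedSeqCount α β i (α (i - 1)) : ℤ) *
        ibinom (α i - β j + 1) ((j : ℤ) - i + 1)
      = (-1) ^ k * ∑ y ∈ Finset.Icc (β j) (α k),
          (boundedSeqCount α β k y : ℤ) * ibinom (y - β j) ((j - k : ℕ) : ℤ) := by
  induction k with
  | zero =>
    simp only [boundedSeqCount]
    rw [sum_mul_ibinom_by_parts (fun _ => ((1 : ℕ) : ℤ))]
    simp [boundedSeqCount]
  | succ k ih =>
    rw [Finset.sum_range_succ, ih (by omega),
      sum_mul_ibinom_by_parts (fun y => (boundedSeqCount α β (k + 1) y : ℤ))]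
    have hcast : ((j - (k + 1) : ℕ) : ℤ) + 1 = ((j - k : ℕ) : ℤ) := by omega
    have hcast' : (j : ℤ) - ((k + 1 : ℕ) : ℤ) + 1 = ((j - k : ℕ) : ℤ) := by omega
    have hmono := hα k (by omega)
    have hdiff : ∑ y ∈ Finset.Icc (β j) (α (k + 1)),
          ((boundedSeqCount α β (k + 1) y : ℤ) - (boundedSeqCount α β (k + 1) (y - 1) : ℤ)) *
            ibinom (y - β j) ((j - k : ℕ) : ℤ)
        = ∑ y ∈ Finset.Icc (β j) (α k),
          (boundedSeqCount α β k y : ℤ) * ibinom (y - β j) ((j - k : ℕ) : ℤ) := by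
      symm
      have hstep (y : ℤ) := boundedSeqCount_succ α β k (y - 1)
      simp only [sub_add_cancel] at hstep
      have hle := hβ k j (by omega) hj
      apply Finset.sum_subset_zero_on_sdiff (Finset.Icc_subset_Icc_right hmono)
      · intro y hy
        simp only [Finset.mem_sdiff, Finset.mem_Icc] at hy
        rw [hstep, if_neg (by omega)]
        simp
      · intro y hy
        simp only [Finset.mem_Icc] at hy
        rw [hstep, if_pos (by omega)]
        simp
    rw [hcast, hcast', hdiff, Nat.add_sub_cancel, boundedSeqCount_succ_of_ge α β k le_rfl,
      boundedSeqCount_succ_of_ge α β k hmono]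
    ring

theorem sum_boundedSeqCount_mul_ibinom_self {n : ℕ} {α β : ℕ → ℤ}
    (hα : ∀ i, i + 1 < n → α i ≤ α (i + 1)) (hβ : ∀ i j, i ≤ j → j < n → β i ≤ β j)
    {j : ℕ} (hj : j < n) :
    ∑ i ∈ Finset.range (j + 1), (-1) ^ i * (boundedSeqCount α β i (α (i - 1)) : ℤ) *
        ibinom (α i - β j + 1) ((j : ℤ) - i + 1)
      = (-1) ^ j * (boundedSeqCount α β (j + 1) (α j) : ℤ) := by
  rw [sum_boundedSeqCount_mul_ibinom hα hβ hj le_rfl, boundedSeqCount_succ_of_ge α β j le_rfl]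
  push_cast
  congr 1
  refine Finset.sum_congr rfl fun y hy => ?_
  rw [Finset.mem_Icc] at hy
  rw [Nat.sub_self, Nat.cast_zero, ibinom_zero_right (by omega), mul_one]

theorem det_ibinom_eq_boundedSeqCount {m : ℕ} {α β : ℕ → ℤ}
    (hα : ∀ i, i + 1 < m + 1 → α i ≤ α (i + 1))
    (hβ : ∀ i j, i ≤ j → j < m + 1 → β i ≤ β j) (hβα : ∀ i, i < m + 1 → β i ≤ α i) :
    Matrix.det (Matrix.of fun i j : Fin (m + 1) =>
        ibinom (α i - β j + 1) (((j : ℕ) : ℤ) - ((i : ℕ) : ℤ) + 1))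
      = boundedSeqCount α β (m + 1) (α m) := by
  set M : Matrix (Fin (m + 1)) (Fin (m + 1)) ℤ := Matrix.of fun i j =>
    ibinom (α i - β j + 1) (((j : ℕ) : ℤ) - ((i : ℕ) : ℤ) + 1) with hM
  have hsub (j : ℕ) (hj : j + 1 < m + 1) :
      ibinom (α (j + 1) - β j + 1) ((j : ℤ) - ((j + 1 : ℕ) : ℤ) + 1) = 1 := by
    have h1 := hα j hj
    have h2 := hβα j (by omega)
    rw [show (j : ℤ) - ((j + 1 : ℕ) : ℤ) + 1 = 0 by push_cast; ring,
      ibinom_zero_right (by omega)]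
  let c : Fin (m + 1) → ℤ := fun i => (-1) ^ (i : ℕ) * (boundedSeqCount α β i (α (i - 1)) : ℤ)
  have hrow (j : Fin (m + 1)) : (∑ k, c k • M k) j =
      ∑ i ∈ Finset.range (m + 1), (-1) ^ i * (boundedSeqCount α β i (α (i - 1)) : ℤ) *
        ibinom (α i - β j + 1) (((j : ℕ) : ℤ) - i + 1) := by
    rw [Finset.sum_apply, ← Fin.sum_univ_eq_sum_range (fun i => (-1) ^ i *
      (boundedSeqCount α β i (α (i - 1)) : ℤ) * ibinom (α i - β j + 1) (((j : ℕ) : ℤ) - i + 1))]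
    rfl
  have hrow_castSucc (j : Fin m) : (∑ k, c k • M k) j.castSucc = 0 := by
    rw [hrow, Fin.val_castSucc,
      ← Finset.sum_subset (Finset.range_subset_range.2 (by omega : (j : ℕ) + 1 + 1 ≤ m + 1)),
      Finset.sum_range_succ, sum_boundedSeqCount_mul_ibinom_self hα hβ (by omega),
      hsub j (by omega), Nat.add_sub_cancel]
    · ring
    · intro i _ hi
      rw [Finset.mem_range] at hi
      rw [ibinom_of_neg (by omega), mul_zero]
  have hrow_last : (∑ k, c k • M k) (Fin.last m) =
      (-1) ^ m * (boundedSeqCount α β (m + 1) (α m) : ℤ) := by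
    rw [hrow, Fin.val_last, sum_boundedSeqCount_mul_ibinom_self hα hβ (by omega)]
  have hc : c 0 = 1 := by simp [c, boundedSeqCount]
  have hminor : ((M.updateRow 0 (∑ k, c k • M k)).submatrix Fin.succ
      (Fin.last m).succAbove).det = 1 := by
    rw [Matrix.det_of_isUpperTriangular]
    · refine Finset.prod_eq_one fun i _ => ?_
      simpa [hM, Matrix.updateRow_apply] using hsub i (by omega)
    · intro i j hij
      replace hij : (j : ℕ) < i := hij
      simp only [Matrix.submatrix_apply, Fin.succAbove_last, Matrix.updateRow_apply,
        Fin.succ_ne_zero, if_false, hM, Matrix.of_apply, Fin.val_succ, Fin.val_castSucc]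
      exact ibinom_of_neg (by omega)
  have hdet := M.det_updateRow_sum 0 c
  rw [hc, one_smul] at hdet
  rw [← hdet, Matrix.det_succ_row_zero, Fin.sum_univ_castSucc, hminor]
  simp only [Matrix.updateRow_self, hrow_castSucc, hrow_last]
  rw [Fin.val_last, Finset.sum_eq_zero (by simp), zero_add, mul_one, ← mul_assoc, ← mul_pow]
  simp

/-- A step of a path counted by `BoundedPaths`. -/
def BoundedStep (a b : ℤ → ℤ) (q q' : ℤ × ℤ) : Prop :=
  (q' - q = ((1 : ℤ), (0 : ℤ)) ∨ q' - q = ((0 : ℤ), (1 : ℤ))) ∧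
    (q' - q = ((1 : ℤ), (0 : ℤ)) → b q'.1 ≤ q.2 ∧ q.2 ≤ a q'.1)

/-- The lattice paths from `A` to `E` all of whose steps are bounded steps. -/
def boundedPathsBetween (a b : ℤ → ℤ) (A E : ℤ × ℤ) : Set (List (ℤ × ℤ)) :=
  {p | p.head? = some A ∧ p.getLast? = some E ∧ List.IsChain (BoundedStep a b) p}

section Paths

variable {a b : ℤ → ℤ}

theorem BoundedStep.le {q q' : ℤ × ℤ} (h : BoundedStep a b q q') : q ≤ q' := by
  obtain ⟨x, y⟩ := q
  obtain ⟨x', y'⟩ := q'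
  simp only [BoundedStep, Prod.mk_sub_mk, Prod.mk.injEq] at h
  rw [Prod.mk_le_mk]
  omega

theorem boundedStep_iff {q : ℤ × ℤ} {x y : ℤ} : BoundedStep a b q (x, y) ↔
    q = (x, y - 1) ∨ (q = (x - 1, y) ∧ b x ≤ y ∧ y ≤ a x) := by
  obtain ⟨x', y'⟩ := q
  simp only [BoundedStep, Prod.mk_sub_mk, Prod.mk.injEq]
  constructor
  · rintro ⟨h1 | h1, h2⟩
    · have := h2 h1
      have : y' = y := by omega
      subst this
      exact Or.inr ⟨by omega, h2 h1⟩
    · exact Or.inl (by omega)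
  · rintro (h | ⟨⟨rfl, rfl⟩, h⟩)
    · omega
    · exact ⟨by omega, fun _ => h⟩

theorem le_of_mem_boundedPathsBetween {A E : ℤ × ℤ} {p : List (ℤ × ℤ)}
    (hp : p ∈ boundedPathsBetween a b A E) : A ≤ E := by
  obtain ⟨hA, hE, hc⟩ := hp
  induction p generalizing A with
  | nil => simp at hA
  | cons q p ih =>
    obtain rfl : q = A := by simpa using hA
    cases p with
    | nil => simp_all
    | cons q' p =>
      rw [List.isChain_cons_cons] at hc
      exact hc.1.le.trans (ih rfl (by simpa using hE) hc.2)

theorem boundedPathsBetween_eq_empty {A E : ℤ × ℤ} (h : ¬A ≤ E) :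
    boundedPathsBetween a b A E = ∅ :=
  Set.eq_empty_of_forall_notMem fun _ hp => h (le_of_mem_boundedPathsBetween hp)

theorem concat_mem_boundedPathsBetween {A E : ℤ × ℤ} {q : List (ℤ × ℤ)} :
    q ++ [E] ∈ boundedPathsBetween a b A E ↔
      (q = [] ∧ A = E) ∨ ∃ B, q ∈ boundedPathsBetween a b A B ∧ BoundedStep a b B E := by
  rcases List.eq_nil_or_concat q with rfl | ⟨q, B, rfl⟩
  · simp [boundedPathsBetween, eq_comm]
  · have hhead : (q.concat B ++ [E]).head? = (q.concat B).head? := by cases q <;> simp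
    simp only [boundedPathsBetween, Set.mem_ofPred_eq, List.isChain_append, hhead]
    simp only [List.concat_eq_append, List.getLast?_concat, List.head?_cons, Option.some.injEq,
      Option.mem_def, List.isChain_singleton, List.append_eq_nil_iff, List.cons_ne_nil]
    constructor
    · rintro ⟨hA, -, hq, -, hs⟩
      exact Or.inr ⟨B, ⟨hA, rfl, hq⟩, hs B rfl E rfl⟩
    · rintro (⟨⟨-, ⟨⟩⟩, -⟩ | ⟨B, ⟨hA, rfl, hq⟩, hs⟩)
      exact ⟨hA, trivial, hq, trivial, by rintro _ rfl _ rfl; exact hs⟩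

theorem mem_boundedPathsBetween_iff {A : ℤ × ℤ} {x y : ℤ} {p : List (ℤ × ℤ)} :
    p ∈ boundedPathsBetween a b A (x, y) ↔
      (p = [(x, y)] ∧ A = (x, y)) ∨
      (p ∈ (fun q => q ++ [(x, y)]) '' boundedPathsBetween a b A (x, y - 1) ∨
      (p ∈ (fun q => q ++ [(x, y)]) '' boundedPathsBetween a b A (x - 1, y) ∧
        b x ≤ y ∧ y ≤ a x)) := by
  constructor
  · intro hp
    obtain ⟨q, rfl⟩ : ∃ q, p = q ++ [(x, y)] := by
      have := hp.2.1
      rw [List.getLast?_eq_some_iff] at this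
      exact this
    rcases concat_mem_boundedPathsBetween.1 hp with ⟨rfl, hA⟩ | ⟨B, hq, hB⟩
    · exact Or.inl ⟨rfl, hA⟩
    · rcases boundedStep_iff.1 hB with rfl | ⟨rfl, h⟩
      · exact Or.inr (Or.inl ⟨q, hq, rfl⟩)
      · exact Or.inr (Or.inr ⟨⟨q, hq, rfl⟩, h⟩)
  · rintro (⟨rfl, hA⟩ | ⟨q, hq, rfl⟩ | ⟨⟨q, hq, rfl⟩, h⟩)
    · exact concat_mem_boundedPathsBetween (q := []).2 (Or.inl ⟨rfl, hA⟩)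
    · exact concat_mem_boundedPathsBetween.2 (Or.inr ⟨_, hq, boundedStep_iff.2 (Or.inl rfl)⟩)
    · exact concat_mem_boundedPathsBetween.2
        (Or.inr ⟨_, hq, boundedStep_iff.2 (Or.inr ⟨rfl, h⟩)⟩)

theorem boundedPathsBetween_self (A : ℤ × ℤ) : boundedPathsBetween a b A A = {[A]} := by
  obtain ⟨x, y⟩ := A
  ext p
  rw [mem_boundedPathsBetween_iff, boundedPathsBetween_eq_empty (by simp),
    boundedPathsBetween_eq_empty (by simp)]
  simp

theorem encard_boundedPathsBetween {A : ℤ × ℤ} {x y : ℤ} (hA : A ≠ (x, y)) :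
    (boundedPathsBetween a b A (x, y)).encard = (boundedPathsBetween a b A (x, y - 1)).encard +
      if b x ≤ y ∧ y ≤ a x then (boundedPathsBetween a b A (x - 1, y)).encard else 0 := by
  have hinj : Function.Injective (fun q : List (ℤ × ℤ) => q ++ [(x, y)]) :=
    List.append_left_injective _
  split_ifs with h
  · rw [← hinj.encard_image (boundedPathsBetween a b A (x, y - 1)),
      ← hinj.encard_image (boundedPathsBetween a b A (x - 1, y)),
      ← Set.encard_union_eq]
    · congr 1
      ext p
      rw [mem_boundedPathsBetween_iff]
      simp [hA, h]
    · rw [Set.disjoint_image_iff hinj, Set.disjoint_left]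
      intro q hq hq'
      have := hq.2.1.symm.trans hq'.2.1
      simp at this
  · rw [← hinj.encard_image (boundedPathsBetween a b A (x, y - 1)), add_zero]
    congr 1
    ext p
    rw [mem_boundedPathsBetween_iff]
    simp [hA, h]

theorem encard_boundedPathsBetween_eq_boundedSeqCount {y₀ : ℤ} {k : ℕ}
    (hb : ∀ i : ℕ, i < k → y₀ ≤ b (i + 1)) {y : ℤ} (hy : y₀ ≤ y) :
    (boundedPathsBetween a b (0, y₀) (k, y)).encard
      = boundedSeqCount (fun i => a (i + 1)) (fun i => b (i + 1)) k y := by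
  induction k generalizing y with
  | zero =>
    induction y, hy using Int.leInduction with
    | base => simp [boundedPathsBetween_self, boundedSeqCount]
    | succ y hy ih =>
      rw [encard_boundedPathsBetween (by simp; omega), add_sub_cancel_right, ih,
        boundedPathsBetween_eq_empty (by simp)]
      simp [boundedSeqCount]
  | succ k ih =>
    have ih' {y : ℤ} (hy : y₀ ≤ y) := ih (fun i hi => hb i (by omega)) hy
    have hbk := hb k (by omega)
    suffices h : ∀ y, y₀ - 1 ≤ y → (boundedPathsBetween a b (0, y₀) ((k + 1 : ℕ), y)).encard
        = boundedSeqCount (fun i => a (i + 1)) (fun i => b (i + 1)) (k + 1) y from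
      h y (by omega)
    intro y hy
    induction y, hy using Int.leInduction with
    | base =>
      rw [boundedPathsBetween_eq_empty (by simp), boundedSeqCount_succ_of_lt _ _ _ (by omega)]
      simp
    | succ y hy ihy =>
      rw [encard_boundedPathsBetween (by simp; omega), add_sub_cancel_right, ihy,
        boundedSeqCount_succ]
      push_cast
      rw [add_sub_cancel_right, ih' (by omega)]

end Paths

theorem statement9 (n : ℕ) (hn : 1 ≤ n) (a b : ℤ → ℤ)
    (ha : ∀ i : ℤ, 1 ≤ i → i < n → a i ≤ a (i + 1))
    (hb : ∀ i : ℤ, 1 ≤ i → i < n → b i ≤ b (i + 1))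
    (hba : ∀ i : ℤ, 1 ≤ i → i ≤ n → b i ≤ a i) :
    ((BoundedPaths n a b).ncard : ℤ)
      = Matrix.det (Matrix.of fun i j : Fin n =>
          ibinom (a ((i : ℕ) + 1) - b ((j : ℕ) + 1) + 1) (((j : ℕ) : ℤ) - ((i : ℕ) : ℤ) + 1)) := by
  obtain ⟨m, rfl⟩ : ∃ m, n = m + 1 := ⟨n - 1, by omega⟩
  have hα : ∀ i : ℕ, i + 1 < m + 1 → a (i + 1) ≤ a ((i + 1 : ℕ) + 1) := fun i hi => by
    simpa using ha (i + 1) (by omega) (by omega)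
  have hβ : ∀ i j : ℕ, i ≤ j → j < m + 1 → b (i + 1) ≤ b (j + 1) := fun i j hij hj => by
    induction j, hij using Nat.le_induction with
    | base => exact le_rfl
    | succ j hij ih =>
      exact (ih (by omega)).trans (by simpa using hb (j + 1) (by omega) (by omega))
  have hβα : ∀ i : ℕ, i < m + 1 → b (i + 1) ≤ a (i + 1) := fun i hi =>
    hba (i + 1) (by omega) (by omega)
  have hb₁ : ∀ i : ℕ, i < m + 1 → b 1 ≤ b (i + 1) := fun i hi => by
    simpa using hβ 0 i (by omega) hi
  rw [det_ibinom_eq_boundedSeqCount (α := fun i => a (i + 1)) (β := fun i => b (i + 1)) hα hβ hβα]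
  have hcard := encard_boundedPathsBetween_eq_boundedSeqCount (a := a) hb₁
    ((hb₁ m (by omega)).trans (hβα m (by omega)))
  have hset : BoundedPaths (m + 1) a b
      = boundedPathsBetween a b (0, b 1) ((m + 1 : ℕ), a (m + 1)) := by
    simp only [BoundedPaths, boundedPathsBetween, Nat.cast_add, Nat.cast_one]
    rfl
  rw [hset, Set.ncard, hcard]
  rfl
end

section
/- Let M_n be the number of Motzkin paths from (0,0) to (n,0) and S_n the number of Schröder paths from (0,0) to (2n,0). Then in the ring of formal power series ℤ[[z]]: (i) (1 − z − 2z²·Σ_{n≥0} M_n z^n)² = 1 − 2z − 3z²; and (ii) (1 − z − 2z·Σ_{n≥0} S_n z^n)² = 1 − 6z + z². (These identities encode the closed forms Σ M_n z^n = (1−z−√(1−2z−3z²))/(2z²) and Σ S_n z^n = (1−z−√(1−6z+z²))/(2z).) -/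
/-- The set of Motzkin paths (as lists of their points) from `A` to `E`: steps
`(1,1)`, `(1,-1)`, `(1,0)`, never passing below the `x`-axis. -/
def MPaths (A E : ℤ × ℤ) : Set (List (ℤ × ℤ)) :=
  {p | p.head? = some A ∧ p.getLast? = some E ∧
       List.Chain' (fun q q' => q' - q = ((1 : ℤ), (1 : ℤ)) ∨ q' - q = ((1 : ℤ), (-1 : ℤ)) ∨
         q' - q = ((1 : ℤ), (0 : ℤ))) p ∧
       ∀ q ∈ p, 0 ≤ q.2}

/-- The set of Schröder paths (as lists of their points) from `A` to `E`: steps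
`(1,1)`, `(1,-1)`, `(2,0)`, never passing below the `x`-axis. -/
def SchPaths (A E : ℤ × ℤ) : Set (List (ℤ × ℤ)) :=
  {p | p.head? = some A ∧ p.getLast? = some E ∧
       List.Chain' (fun q q' => q' - q = ((1 : ℤ), (1 : ℤ)) ∨ q' - q = ((1 : ℤ), (-1 : ℤ)) ∨
         q' - q = ((2 : ℤ), (0 : ℤ))) p ∧
       ∀ q ∈ p, 0 ≤ q.2}

/-- Nonnegative lattice paths (as lists of their points) from `A` to `E` with steps `(1, 1)`,
`(1, -1)` and `(l, 0)`. -/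
def levelPaths (l : ℤ) (A E : ℤ × ℤ) : Set (List (ℤ × ℤ)) :=
  {p | p.head? = some A ∧ p.getLast? = some E ∧
       List.IsChain (fun q q' => q' - q = ((1 : ℤ), (1 : ℤ)) ∨ q' - q = ((1 : ℤ), (-1 : ℤ)) ∨
         q' - q = (l, (0 : ℤ))) p ∧
       ∀ q ∈ p, 0 ≤ q.2}

theorem add_le_add_of_mem_levelPaths {l : ℤ} (hl : 0 ≤ l) {E : ℤ × ℤ} {p : List (ℤ × ℤ)}
    {A : ℤ × ℤ} (hp : p ∈ levelPaths l A E) : A.1 + A.2 ≤ E.1 + E.2 := by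
  induction p generalizing A with
  | nil => simp [levelPaths] at hp
  | cons a t ih =>
    obtain ⟨h1, h2, h3, h4⟩ := hp
    obtain rfl : a = A := by simpa using h1
    cases t with
    | nil =>
      obtain rfl : a = E := by simpa using h2
      exact le_rfl
    | cons b t =>
      rw [List.isChain_cons_cons] at h3
      have := ih (A := b) ⟨rfl, by simpa using h2, h3.2, fun q hq => h4 q (by simp_all)⟩
      simp only [Prod.ext_iff, Prod.fst_sub, Prod.snd_sub] at h3
      omega

theorem levelPaths_eq_empty_of_lt {l : ℤ} (hl : 0 ≤ l) {A E : ℤ × ℤ}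
    (h : E.1 + E.2 < A.1 + A.2) : levelPaths l A E = ∅ :=
  Set.eq_empty_of_forall_notMem fun _ hp => h.not_ge (add_le_add_of_mem_levelPaths hl hp)

theorem levelPaths_eq_empty_of_neg {l : ℤ} {A E : ℤ × ℤ} (h : A.2 < 0) :
    levelPaths l A E = ∅ :=
  Set.eq_empty_of_forall_notMem fun _ hp => h.not_ge (hp.2.2.2 A (List.mem_of_head? hp.1))

theorem levelPaths_eq_union {l : ℤ} {A E : ℤ × ℤ} (hA : 0 ≤ A.2) :
    levelPaths l A E = {p | p = [A] ∧ A = E} ∪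
      List.cons A '' (levelPaths l (A + (1, 1)) E ∪
        (levelPaths l (A + (1, -1)) E ∪ levelPaths l (A + (l, 0)) E)) := by
  ext p
  rcases p with _ | ⟨a, _ | ⟨b, t⟩⟩
  · simp [levelPaths]
  · simp only [levelPaths, Set.mem_union, Set.mem_image, Set.mem_ofPred_eq]
    constructor
    · rintro ⟨h1, h2, -⟩
      simp_all
    · rintro (⟨h1, h2⟩ | ⟨q, hq, hqa⟩)
      · simp_all
      · obtain ⟨rfl, rfl⟩ : A = a ∧ q = [] := by simpa using hqa
        simp at hq
  · simp only [levelPaths, Set.mem_union, Set.mem_image, Set.mem_ofPred_eq, List.head?_cons,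
      Option.some.injEq, List.cons.injEq, List.getLast?_cons_cons, List.isChain_cons_cons,
      sub_eq_iff_eq_add', reduceCtorEq, and_false, false_and, false_or]
    constructor
    · rintro ⟨rfl, h2, ⟨h3, h4⟩, h5⟩
      have h6 : ∀ q ∈ b :: t, 0 ≤ q.2 := fun q hq => h5 q (List.mem_cons_of_mem _ hq)
      exact ⟨b :: t, by simp only [List.head?_cons, Option.some.injEq]; tauto, rfl, rfl⟩
    · rintro ⟨q, hq, rfl, rfl⟩
      simp only [List.head?_cons, Option.some.injEq] at hq
      have h6 : (∀ q ∈ b :: t, 0 ≤ q.2) → ∀ q ∈ A :: b :: t, 0 ≤ q.2 := fun h =>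
        List.forall_mem_cons.2 ⟨hA, h⟩
      tauto

theorem disjoint_levelPaths {l : ℤ} {A B E : ℤ × ℤ} (h : A ≠ B) :
    Disjoint (levelPaths l A E) (levelPaths l B E) :=
  Set.disjoint_left.2 fun _ hp hq => h (Option.some.inj (hp.1.symm.trans hq.1))

theorem encard_levelPaths {l : ℤ} {A E : ℤ × ℤ} (hA : 0 ≤ A.2) (hAE : A ≠ E) :
    (levelPaths l A E).encard = (levelPaths l (A + (1, 1)) E).encard +
      ((levelPaths l (A + (1, -1)) E).encard + (levelPaths l (A + (l, 0)) E).encard) := by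
  have h : {p | p = [A] ∧ A = E} = (∅ : Set (List (ℤ × ℤ))) := by simp [hAE]
  rw [levelPaths_eq_union hA, h, Set.empty_union, List.cons_injective.encard_image,
    Set.encard_union_eq, Set.encard_union_eq]
  · exact disjoint_levelPaths (by simp)
  · exact Set.disjoint_union_right.2
      ⟨disjoint_levelPaths (by simp), disjoint_levelPaths (by simp)⟩

theorem encard_levelPaths_self {l : ℤ} (hl : 0 < l) (e : ℤ) :
    (levelPaths l (e, 0) (e, 0)).encard = 1 := by
  rw [levelPaths_eq_union le_rfl, levelPaths_eq_empty_of_lt hl.le (by simp),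
    levelPaths_eq_empty_of_neg (by simp), levelPaths_eq_empty_of_lt hl.le (by simpa)]
  simp

/-- The number of Motzkin paths with `n` steps from height `h` to height `0`. -/
def motzkinCount : ℕ → ℕ → ℕ
  | 0, 0 => 1
  | 0, _ + 1 => 0
  | n + 1, 0 => motzkinCount n 0 + motzkinCount n 1
  | n + 1, h + 1 => motzkinCount n h + (motzkinCount n (h + 1) + motzkinCount n (h + 2))

/-- The number of Schröder paths of horizontal extent `2 * n + h` from height `h` to
height `0`. -/
def schroederCount : ℕ → ℕ → ℕ
  | 0, 0 => 1
  | 0, h + 1 => schroederCount 0 h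
  | n + 1, 0 => schroederCount n 0 + schroederCount n 1
  | n + 1, h + 1 =>
    schroederCount (n + 1) h + (schroederCount n (h + 1) + schroederCount n (h + 2))
termination_by n h => (n, h)

theorem encard_levelPaths_one (e : ℤ) (n h : ℕ) :
    (levelPaths 1 (e - n, h) (e, 0)).encard = motzkinCount n h := by
  induction n generalizing h with
  | zero =>
    cases h with
    | zero => simpa [motzkinCount] using encard_levelPaths_self one_pos e
    | succ h =>
      rw [levelPaths_eq_empty_of_lt zero_le_one (by push_cast; omega)]
      simp [motzkinCount]
  | succ n ih =>
    rw [encard_levelPaths (by simp) (by simp; omega)]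
    have hup : ((e - (n + 1 : ℕ), (h : ℤ)) : ℤ × ℤ) + (1, 1) =
        ((e - n, ((h + 1 : ℕ) : ℤ)) : ℤ × ℤ) := by
      ext <;> simp; ring
    have hlevel : ((e - (n + 1 : ℕ), (h : ℤ)) : ℤ × ℤ) + (1, 0) = ((e - n, (h : ℤ)) : ℤ × ℤ) := by
      ext <;> simp; ring
    rw [hup, hlevel, ih, ih]
    cases h with
    | zero =>
      rw [levelPaths_eq_empty_of_neg (by simp)]
      simp [motzkinCount, add_comm]
    | succ h =>
      have hdown : ((e - (n + 1 : ℕ), ((h + 1 : ℕ) : ℤ)) : ℤ × ℤ) + (1, -1) =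
          ((e - n, (h : ℤ)) : ℤ × ℤ) := by
        ext <;> simp; ring
      rw [hdown, ih, motzkinCount]
      push_cast
      ring

theorem encard_levelPaths_two (e : ℤ) (n h : ℕ) :
    (levelPaths 2 (e - (2 * n + h), h) (e, 0)).encard = schroederCount n h := by
  induction n generalizing h with
  | zero =>
    induction h with
    | zero => simpa [schroederCount] using encard_levelPaths_self two_pos e
    | succ h ih =>
      have hdown : ((e - (2 * (0 : ℕ) + (h + 1 : ℕ)), ((h + 1 : ℕ) : ℤ)) : ℤ × ℤ) + (1, -1) =
          ((e - (2 * (0 : ℕ) + h), (h : ℤ)) : ℤ × ℤ) := by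
        ext <;> simp; ring
      rw [encard_levelPaths (Int.natCast_nonneg _) (by simp; omega), hdown, ih,
        levelPaths_eq_empty_of_lt zero_le_two (by simp; omega),
        levelPaths_eq_empty_of_lt zero_le_two (by simp; omega)]
      simp [schroederCount]
  | succ n ih =>
    have hup (h : ℕ) : ((e - (2 * (n + 1 : ℕ) + h), (h : ℤ)) : ℤ × ℤ) + (1, 1) =
        ((e - (2 * n + (h + 1 : ℕ)), ((h + 1 : ℕ) : ℤ)) : ℤ × ℤ) := by
      ext <;> simp; ring
    have hlevel (h : ℕ) : ((e - (2 * (n + 1 : ℕ) + h), (h : ℤ)) : ℤ × ℤ) + (2, 0) =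
        ((e - (2 * n + h), (h : ℤ)) : ℤ × ℤ) := by
      ext <;> simp; ring
    induction h with
    | zero =>
      rw [encard_levelPaths (by simp) (by simp; omega), hup, hlevel, ih, ih,
        levelPaths_eq_empty_of_neg (by simp)]
      simp [schroederCount, add_comm]
    | succ h ih' =>
      have hdown : ((e - (2 * (n + 1 : ℕ) + (h + 1 : ℕ)), ((h + 1 : ℕ) : ℤ)) : ℤ × ℤ) + (1, -1) =
          ((e - (2 * (n + 1 : ℕ) + h), (h : ℤ)) : ℤ × ℤ) := by
        ext <;> simp; ring
      rw [encard_levelPaths (Int.natCast_nonneg _) (by simp; omega), hup, hlevel, hdown, ih, ih, ih',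
        schroederCount]
      push_cast
      ring

theorem ncard_MPaths (n : ℕ) : (MPaths (0, 0) ((n : ℤ), 0)).ncard = motzkinCount n 0 := by
  have h := encard_levelPaths_one n n 0
  rw [sub_self] at h
  exact congrArg ENat.toNat h

theorem ncard_SchPaths (n : ℕ) :
    (SchPaths (0, 0) ((2 * n : ℤ), 0)).ncard = schroederCount n 0 := by
  have h := encard_levelPaths_two (2 * n) n 0
  rw [Nat.cast_zero, add_zero, sub_self] at h
  exact congrArg ENat.toNat h

namespace PowerSeries

variable {R : Type*} [CommRing R]

theorem eq_zero_of_level_recurrence (a : R⟦X⟧) (D : ℕ → R⟦X⟧)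
    (h₀ : D 0 = X * (D 0 + D 1))
    (hs : ∀ h, D (h + 1) = a * D h + X * (D (h + 1) + D (h + 2))) (h : ℕ) : D h = 0 := by
  have key (n : ℕ) : ∀ h, X ^ n ∣ D h := by
    induction n with
    | zero => simp
    | succ n ih =>
      intro h
      rw [pow_succ']
      induction h with
      | zero =>
        rw [h₀]
        exact mul_dvd_mul_left X (dvd_add (ih 0) (ih 1))
      | succ h ih' =>
        rw [hs]
        exact dvd_add (ih'.mul_left a) (mul_dvd_mul_left X (dvd_add (ih _) (ih _)))
  ext n
  exact X_pow_dvd_iff.1 (key (n + 1) h) n n.lt_succ_self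

theorem sq_eq_of_level_recurrence (a : R⟦X⟧) (A : ℕ → R⟦X⟧)
    (h₀ : A 0 = 1 + X * (A 0 + A 1))
    (hs : ∀ h, A (h + 1) = a * A h + X * (A (h + 1) + A (h + 2))) :
    (1 - X - 2 * (a * X) * A 0) ^ 2 = (1 - X) ^ 2 - 4 * (a * X) := by
  have h₁ := eq_zero_of_level_recurrence a (fun h => A (h + 1) - a * A 0 * A h)
    (by linear_combination hs 0 - a * A 0 * h₀)
    (fun h => by linear_combination hs (h + 1) - a * A 0 * hs h) 0
  linear_combination (-4 * a * X) * h₀ - 4 * a * X * X * h₁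

end PowerSeries

theorem statement13 :
    ((1 - PowerSeries.X - 2 * PowerSeries.X ^ 2 *
          PowerSeries.mk (fun n => ((MPaths (0, 0) ((n : ℤ), 0)).ncard : ℤ)) :
        PowerSeries ℤ)) ^ 2
        = 1 - 2 * PowerSeries.X - 3 * PowerSeries.X ^ 2
    ∧ ((1 - PowerSeries.X - 2 * PowerSeries.X *
          PowerSeries.mk (fun n => ((SchPaths (0, 0) ((2 * n : ℤ), 0)).ncard : ℤ)) :
        PowerSeries ℤ)) ^ 2
        = 1 - 6 * PowerSeries.X + PowerSeries.X ^ 2 := by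
  constructor
  · have h := PowerSeries.sq_eq_of_level_recurrence (PowerSeries.X : PowerSeries ℤ)
      (fun h => PowerSeries.mk fun n => (motzkinCount n h : ℤ))
      (by ext (_ | n) <;> simp [motzkinCount, PowerSeries.coeff_succ_X_mul, PowerSeries.coeff_one])
      (fun h => by ext (_ | n) <;> simp [motzkinCount, PowerSeries.coeff_succ_X_mul])
    simp only [ncard_MPaths]
    linear_combination h
  · have h := PowerSeries.sq_eq_of_level_recurrence (1 : PowerSeries ℤ)
      (fun h => PowerSeries.mk fun n => (schroederCount n h : ℤ))
      (by ext (_ | n) <;>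
        simp [schroederCount, PowerSeries.coeff_succ_X_mul, PowerSeries.coeff_one])
      (fun h => by ext (_ | n) <;> simp [schroederCount, PowerSeries.coeff_succ_X_mul])
    simp only [ncard_SchPaths]
    linear_combination h
end

section
/- (Lindström's lemma / Lindström–Gessel–Viennot.) Let V be a finite set, E ⊆ V × V a set of directed edges such that the digraph (V, E) contains no nontrivial directed cycle, and let w : V × V → R assign weights in a commutative ring R. For vertices A₁, …, A_n and E₁, …, E_n of V, one has Σ_{σ ∈ S_n} sgn(σ) · Σ_{(P₁,…,P_n)} w(P₁)⋯w(P_n) = det_{1≤i,j≤n}( Σ_{P : A_j → E_i} w(P) ), where the inner sum on the left is over all families (P₁, …, P_n) of pairwise vertex-disjoint paths with P_i a path from A_{σ(i)} to E_i, and the sum inside the determinant is over all paths P from A_j to E_i. -/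
/-- A path in the digraph with vertex set `V` and edge set `Edg ⊆ V × V`, from `u` to `v`,
given as the (nonempty) list of its vertices. -/
def IsDPath {V : Type*} (Edg : Set (V × V)) (u v : V) (p : List V) : Prop :=
  p.head? = some u ∧ p.getLast? = some v ∧ List.Chain' (fun x y => (x, y) ∈ Edg) p

/-- The weight of a path: the product of the edge weights `w` over its edges. -/
def dweight {V R : Type*} [CommRing R] (w : V × V → R) : List V → R
  | [] => 1
  | [_] => 1
  | x :: y :: rest => w (x, y) * dweight w (y :: rest)

section LGV

open Finset

variable {V R : Type*} [CommRing R]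

theorem List.IsChain.nodup_of_acyclic {Edg : Set (V × V)}
    (hacyc : ∀ v : V, ∀ p : List V, IsDPath Edg v v p → p.length ≤ 1) :
    ∀ p : List V, List.IsChain (fun x y => (x, y) ∈ Edg) p → p.Nodup
  | [], _ => List.nodup_nil
  | x :: l, h => by
    refine List.nodup_cons.2 ⟨fun hx => ?_, nodup_of_acyclic hacyc l h.tail⟩
    obtain ⟨l₁, l₂, rfl⟩ := List.append_of_mem hx
    have hc : List.IsChain (fun x y => (x, y) ∈ Edg) ((x :: l₁ ++ [x]) ++ l₂) := by simpa using h
    have := hacyc x (x :: l₁ ++ [x]) ⟨by simp, List.getLast?_concat, hc.left_of_append⟩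
    simp at this

theorem finite_isDPath [Finite V] {Edg : Set (V × V)}
    (hacyc : ∀ v : V, ∀ p : List V, IsDPath Edg v v p → p.length ≤ 1) (u v : V) :
    {p : List V | IsDPath Edg u v p}.Finite := by
  have := Fintype.ofFinite V
  refine (List.finite_length_le V (Fintype.card V)).subset fun p hp => ?_
  exact (List.IsChain.nodup_of_acyclic hacyc p hp.2.2).length_le_card

open Classical in
/-- Follow `p` until just before its first visit to `v`, then `q` from its first visit to `v`. -/
noncomputable def splice (v : V) (p q : List V) : List V :=
  p.takeWhile (· ≠ v) ++ q.dropWhile (· ≠ v)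

theorem splice_self (v : V) (p : List V) : splice v p p = p :=
  List.takeWhile_append_dropWhile

theorem exists_first_visit {v : V} {p : List V} (h : v ∈ p) :
    ∃ p₁ p₂, p = p₁ ++ v :: p₂ ∧ v ∉ p₁ := by
  obtain ⟨p₁, p₂, h₁, h₂⟩ := List.eq_append_cons_of_mem h
  exact ⟨p₁, p₂, h₁, h₂⟩

open Classical in
theorem takeWhile_first_visit {v : V} {p₁ : List V} (h : v ∉ p₁) (p₂ : List V) :
    (p₁ ++ v :: p₂).takeWhile (· ≠ v) = p₁ := by
  rw [List.takeWhile_append_of_pos]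
  · simp
  · intro a ha
    simpa using fun e : a = v => h (e ▸ ha)

open Classical in
theorem dropWhile_first_visit {v : V} {p₁ : List V} (h : v ∉ p₁) (p₂ : List V) :
    (p₁ ++ v :: p₂).dropWhile (· ≠ v) = v :: p₂ := by
  rw [List.dropWhile_append_of_pos]
  · simp
  · intro a ha
    simpa using fun e : a = v => h (e ▸ ha)

theorem splice_first_visit {v : V} {p₁ q₁ : List V} (hp : v ∉ p₁) (hq : v ∉ q₁)
    (p₂ q₂ : List V) : splice v (p₁ ++ v :: p₂) (q₁ ++ v :: q₂) = p₁ ++ v :: q₂ := by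
  rw [splice, takeWhile_first_visit hp, dropWhile_first_visit hq]

theorem mem_splice_self {v : V} {p q : List V} (hp : v ∈ p) (hq : v ∈ q) : v ∈ splice v p q := by
  obtain ⟨p₁, p₂, rfl, hp₁⟩ := exists_first_visit hp
  obtain ⟨q₁, q₂, rfl, hq₁⟩ := exists_first_visit hq
  simp [splice_first_visit hp₁ hq₁]

theorem splice_splice {v : V} {p q : List V} (hp : v ∈ p) (hq : v ∈ q) :
    splice v (splice v p q) (splice v q p) = p := by
  obtain ⟨p₁, p₂, rfl, hp₁⟩ := exists_first_visit hp
  obtain ⟨q₁, q₂, rfl, hq₁⟩ := exists_first_visit hq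
  rw [splice_first_visit hp₁ hq₁, splice_first_visit hq₁ hp₁, splice_first_visit hp₁ hq₁]

theorem IsDPath.splice {Edg : Set (V × V)} {u u' x y v : V} {p q : List V}
    (hp : IsDPath Edg u x p) (hq : IsDPath Edg u' y q) (hvp : v ∈ p) (hvq : v ∈ q) :
    IsDPath Edg u y (splice v p q) := by
  obtain ⟨p₁, p₂, rfl, hp₁⟩ := exists_first_visit hvp
  obtain ⟨q₁, q₂, rfl, hq₁⟩ := exists_first_visit hvq
  rw [splice_first_visit hp₁ hq₁]
  obtain ⟨hp1, -, hp3⟩ := hp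
  obtain ⟨-, hq2, hq3⟩ := hq
  refine ⟨?_, ?_, ?_⟩
  · cases p₁ <;> simpa using hp1
  · simpa [List.getLast?_append] using hq2
  · have h₁ := List.isChain_split.1 hp3
    have h₂ := List.isChain_split.1 hq3
    exact List.isChain_split.2 ⟨h₁.1, h₂.2⟩

theorem dweight_append_cons (w : V × V → R) (v : V) (p₂ : List V) :
    ∀ p₁ : List V, dweight w (p₁ ++ v :: p₂) = dweight w (p₁ ++ [v]) * dweight w (v :: p₂)
  | [] => by simp [dweight]
  | [x] => by simp [dweight]
  | x :: y :: l => by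
    have := dweight_append_cons w v p₂ (y :: l)
    simp only [List.cons_append, dweight] at this ⊢
    rw [this, mul_assoc]

open Classical in
theorem dweight_splice (w : V × V → R) {v : V} {p q : List V} (hp : v ∈ p) (hq : v ∈ q) :
    dweight w (splice v p q) =
      dweight w (p.takeWhile (· ≠ v) ++ [v]) * dweight w (q.dropWhile (· ≠ v)) := by
  obtain ⟨p₁, p₂, rfl, hp₁⟩ := exists_first_visit hp
  obtain ⟨q₁, q₂, rfl, hq₁⟩ := exists_first_visit hq
  rw [splice_first_visit hp₁ hq₁, takeWhile_first_visit hp₁, dropWhile_first_visit hq₁,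
    dweight_append_cons]

variable {ι : Type*}

/-- Exchange the initial segments, up to `v`, of the members of a family according to `s`. -/
noncomputable def exchange (v : V) (s : Equiv.Perm ι) (F : ι → List V) (k : ι) : List V :=
  splice v (F (s k)) (F k)

theorem exchange_of_fixed {v : V} {s : Equiv.Perm ι} {F : ι → List V} {k : ι} (h : s k = k) :
    exchange v s F k = F k := by
  rw [exchange, h, splice_self]

theorem mem_of_moved {v : V} {s : Equiv.Perm ι} {F : ι → List V}
    (hv : ∀ k, s k ≠ k → v ∈ F k) {k : ι} (h : s k ≠ k) : v ∈ F (s k) :=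
  hv _ fun e => h (s.injective e)

theorem mem_exchange_self {v : V} {s : Equiv.Perm ι} {F : ι → List V}
    (hv : ∀ k, s k ≠ k → v ∈ F k) (k : ι) : v ∈ exchange v s F k ↔ v ∈ F k := by
  by_cases h : s k = k
  · rw [exchange_of_fixed h]
  · exact iff_of_true (mem_splice_self (mem_of_moved hv h) (hv k h)) (hv k h)

theorem exchange_exchange {v : V} {s : Equiv.Perm ι} {F : ι → List V} (hs : ∀ k, s (s k) = k)
    (hv : ∀ k, s k ≠ k → v ∈ F k) : exchange v s (exchange v s F) = F := by
  funext k
  by_cases h : s k = k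
  · rw [exchange_of_fixed h, exchange_of_fixed h]
  · rw [exchange, exchange, exchange, hs, splice_splice (hv k h) (mem_of_moved hv h)]

theorem prod_dweight_exchange [Fintype ι] (w : V × V → R) {v : V} {s : Equiv.Perm ι}
    {F : ι → List V} (hv : ∀ k, s k ≠ k → v ∈ F k) :
    ∏ k, dweight w (exchange v s F k) = ∏ k, dweight w (F k) := by
  classical
  let a : ι → R := fun k =>
    if s k = k then 1 else dweight w ((F k).takeWhile (· ≠ v) ++ [v])
  let b : ι → R := fun k =>
    if s k = k then dweight w (F k) else dweight w ((F k).dropWhile (· ≠ v))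
  have h₁ : ∀ k, dweight w (F k) = a k * b k := fun k => by
    by_cases h : s k = k
    · simp [a, b, h]
    · simp only [a, b, h, if_false]
      rw [← dweight_splice w (hv k h) (hv k h), splice_self]
  have h₂ : ∀ k, dweight w (exchange v s F k) = a (s k) * b k := fun k => by
    by_cases h : s k = k
    · simp [a, b, h, exchange_of_fixed h]
    · have h' : s (s k) ≠ s k := fun e => h (s.injective e)
      simp only [a, b, h, h', if_false]
      exact dweight_splice w (mem_of_moved hv h) (hv k h)
  simp only [h₁, h₂, prod_mul_distrib, Equiv.prod_comp s a]

/-- The vertices shared by at least two members of a family. -/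
def crossings (F : ι → List V) : Set V :=
  {u | ∃ i j, i ≠ j ∧ u ∈ F i ∧ u ∈ F j}

theorem crossings_exchange_subset {v : V} {s : Equiv.Perm ι} {F : ι → List V}
    (hF : ∀ k, (F k).Nodup) : crossings (exchange v s F) ⊆ crossings F := by
  classical
  have mixed : ∀ {u : V} {a b : ι}, u ∈ (F (s a)).takeWhile (· ≠ v) →
      u ∈ (F b).dropWhile (· ≠ v) → u ∈ crossings F := by
    intro u a b ha hb
    refine ⟨s a, b, ?_, (List.takeWhile_prefix _).subset ha, (List.dropWhile_suffix _).subset hb⟩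
    rintro rfl
    have := hF (s a)
    rw [← List.takeWhile_append_dropWhile (p := fun x => decide (x ≠ v)) (l := F (s a))] at this
    exact List.disjoint_of_nodup_append this ha hb
  rintro u ⟨a, b, hab, ha, hb⟩
  rw [exchange, splice, List.mem_append] at ha hb
  rcases ha with ha | ha <;> rcases hb with hb | hb
  · exact ⟨s a, s b, fun e => hab (s.injective e), (List.takeWhile_prefix _).subset ha,
      (List.takeWhile_prefix _).subset hb⟩
  · exact mixed ha hb
  · exact mixed hb ha
  · exact ⟨a, b, hab, (List.dropWhile_suffix _).subset ha, (List.dropWhile_suffix _).subset hb⟩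

variable {Edg : Set (V × V)}

theorem isDPath_exchange {A E : ι → V} {σ s : Equiv.Perm ι} {F : ι → List V} {v : V}
    (hF : ∀ i, IsDPath Edg (A (σ i)) (E i) (F i)) (hv : ∀ k, s k ≠ k → v ∈ F k) (k : ι) :
    IsDPath Edg (A ((σ * s) k)) (E k) (exchange v s F k) := by
  by_cases h : s k = k
  · rw [exchange_of_fixed h, Equiv.Perm.mul_apply, h]
    exact hF k
  · exact (hF (s k)).splice (hF k) (mem_of_moved hv h) (hv k h)

theorem crossings_exchange {v : V} {s : Equiv.Perm ι} {F : ι → List V} (hs : ∀ k, s (s k) = k)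
    (hv : ∀ k, s k ≠ k → v ∈ F k) (hF : ∀ k, (F k).Nodup)
    (hF' : ∀ k, (exchange v s F k).Nodup) : crossings (exchange v s F) = crossings F := by
  refine (crossings_exchange_subset hF).antisymm ?_
  conv_lhs => rw [← exchange_exchange hs hv]
  exact crossings_exchange_subset hF'

/-- Terms of the determinant expansion that come from intersecting families cancel. -/
theorem sum_intersecting_eq_zero [Fintype ι] [DecidableEq ι] (w : V × V → R)
    (hacyc : ∀ v : V, ∀ p : List V, IsDPath Edg v v p → p.length ≤ 1) (A E : ι → V)
    (T : Finset (Σ _ : Equiv.Perm ι, ι → List V))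
    (hT : ∀ x, x ∈ T ↔ (∀ i, IsDPath Edg (A (x.1 i)) (E i) (x.2 i)) ∧ (crossings x.2).Nonempty) :
    ∑ x ∈ T, ((Equiv.Perm.sign x.1 : ℤ) : R) * ∏ i, dweight w (x.2 i) = 0 := by
  rcases isEmpty_or_nonempty V with hV | hV
  · exact sum_eq_zero fun x hx => isEmptyElim ((hT x).1 hx).2.some
  -- The choices depend only on data that the exchange leaves unchanged.
  have hc : ∀ X : Set V, ∃ v, X.Nonempty → v ∈ X := fun X => by
    by_cases h : X.Nonempty
    · exact ⟨h.some, fun _ => h.some_mem⟩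
    · exact ⟨hV.some, fun h' => absurd h' h⟩
  have hs : ∀ K : Set ι, ∃ s : Equiv.Perm ι,
      K.Nontrivial → ∃ i ∈ K, ∃ j ∈ K, i ≠ j ∧ s = Equiv.swap i j := fun K => by
    by_cases h : K.Nontrivial
    · obtain ⟨i, hi, j, hj, hij⟩ := h
      exact ⟨Equiv.swap i j, fun _ => ⟨i, hi, j, hj, hij, rfl⟩⟩
    · exact ⟨1, fun h' => absurd h' h⟩
  choose c hc using hc
  choose s hs using hs
  let vt : (ι → List V) → V := fun F => c (crossings F)
  let sw : (ι → List V) → Equiv.Perm ι := fun F => s {k | vt F ∈ F k}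
  let g : (Σ _ : Equiv.Perm ι, ι → List V) → (Σ _ : Equiv.Perm ι, ι → List V) :=
    fun x => ⟨x.1 * sw x.2, exchange (vt x.2) (sw x.2) x.2⟩
  have hsw : ∀ F, (crossings F).Nonempty →
      ∃ i ∈ {k | vt F ∈ F k}, ∃ j ∈ {k | vt F ∈ F k}, i ≠ j ∧ sw F = Equiv.swap i j := by
    intro F hF
    obtain ⟨i, j, hij, hi, hj⟩ := hc _ hF
    exact hs _ ⟨i, hi, j, hj, hij⟩
  have hinv : ∀ F, (crossings F).Nonempty → ∀ k, sw F (sw F k) = k := by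
    intro F hF k
    obtain ⟨i, -, j, -, -, h⟩ := hsw F hF
    rw [h, Equiv.swap_apply_self]
  have hmoved : ∀ F, (crossings F).Nonempty → ∀ k, sw F k ≠ k → vt F ∈ F k := by
    intro F hF k hk
    obtain ⟨i, hi, j, hj, -, h⟩ := hsw F hF
    rw [h] at hk
    rcases (Equiv.swap_apply_ne_self_iff.1 hk).2 with rfl | rfl
    exacts [hi, hj]
  have hsign : ∀ F, (crossings F).Nonempty → Equiv.Perm.sign (sw F) = -1 := by
    intro F hF
    obtain ⟨i, -, j, -, hij, h⟩ := hsw F hF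
    rw [h, Equiv.Perm.sign_swap hij]
  have hpath : ∀ x ∈ T, ∀ i, IsDPath Edg (A ((g x).1 i)) (E i) ((g x).2 i) := fun x hx =>
    isDPath_exchange ((hT x).1 hx).1 (hmoved _ ((hT x).1 hx).2)
  have hcross : ∀ x ∈ T, crossings (g x).2 = crossings x.2 := fun x hx =>
    have hx' := (hT x).1 hx
    crossings_exchange (hinv _ hx'.2) (hmoved _ hx'.2)
      (fun k => List.IsChain.nodup_of_acyclic hacyc _ (hx'.1 k).2.2)
      (fun k => List.IsChain.nodup_of_acyclic hacyc _ (hpath x hx k).2.2)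
  have hvt : ∀ x ∈ T, vt (g x).2 = vt x.2 := fun x hx => congrArg c (hcross x hx)
  have hsw' : ∀ x ∈ T, sw (g x).2 = sw x.2 := fun x hx => by
    refine congrArg s (Set.ext fun k => ?_)
    rw [Set.mem_ofPred_eq, hvt x hx]
    exact mem_exchange_self (hmoved _ ((hT x).1 hx).2) k
  refine sum_involution (fun x _ => g x) ?_ ?_ ?_ ?_
  · intro x hx
    have hx' := ((hT x).1 hx).2
    simp only [g, prod_dweight_exchange w (hmoved _ hx'), Equiv.Perm.sign_mul, hsign _ hx']
    simp
  · intro x hx _ h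
    have hx' := ((hT x).1 hx).2
    have h1 : x.1 * sw x.2 = x.1 := congrArg Sigma.fst h
    have h2 := hsign _ hx'
    rw [mul_eq_left.1 h1, Equiv.Perm.sign_one] at h2
    exact absurd h2 (by decide)
  · intro x hx
    exact (hT _).2 ⟨hpath x hx, (hcross x hx).symm ▸ ((hT x).1 hx).2⟩
  · intro x hx
    have hx' := ((hT x).1 hx).2
    have h1 : (g (g x)).1 = x.1 := by
      change x.1 * sw x.2 * sw (g x).2 = x.1
      rw [hsw' x hx, mul_assoc]
      exact Equiv.ext fun k => congrArg x.1 (hinv _ hx' k)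
    have h2 : (g (g x)).2 = x.2 := by
      change exchange (vt (g x).2) (sw (g x).2) (g x).2 = x.2
      rw [hsw' x hx, hvt x hx]
      exact exchange_exchange (hinv _ hx') (hmoved _ hx')
    exact Sigma.ext h1 (heq_of_eq h2)

end LGV

/-- **Lindström–Gessel–Viennot lemma.** -/
theorem statement17 (V : Type*) [Fintype V] (R : Type*) [CommRing R]
    (Edg : Set (V × V)) (w : V × V → R)
    (hacyc : ∀ v : V, ∀ p : List V, IsDPath Edg v v p → p.length ≤ 1)
    (n : ℕ) (A E : Fin n → V) :
    ∑ σ : Equiv.Perm (Fin n), ((Equiv.Perm.sign σ : ℤ) : R) *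
        ∑ᶠ F ∈ {F : Fin n → List V |
            (∀ i, IsDPath Edg (A (σ i)) (E i) (F i)) ∧
            ∀ i j, i ≠ j → ∀ v ∈ F i, v ∉ F j},
          ∏ i, dweight w (F i)
      = Matrix.det (Matrix.of fun i j : Fin n =>
          ∑ᶠ P ∈ {P : List V | IsDPath Edg (A j) (E i) P}, dweight w P) := by
  classical
  let P : V → V → Finset (List V) := fun u v => (finite_isDPath hacyc u v).toFinset
  have hP : ∀ u v p, p ∈ P u v ↔ IsDPath Edg u v p := fun u v p => by simp [P]
  let fam : Equiv.Perm (Fin n) → Finset (Fin n → List V) := fun σ =>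
    Fintype.piFinset fun i => P (A (σ i)) (E i)
  have hfam : ∀ σ F, F ∈ fam σ ↔ ∀ i, IsDPath Edg (A (σ i)) (E i) (F i) := fun σ F => by
    simp [fam, hP]
  have hdisj : ∀ F : Fin n → List V,
      (∀ i j, i ≠ j → ∀ v ∈ F i, v ∉ F j) ↔ ¬ (crossings F).Nonempty := fun F => by
    constructor
    · rintro h ⟨v, i, j, hij, hi, hj⟩
      exact h i j hij v hi hj
    · intro h i j hij v hi hj
      exact h ⟨v, i, j, hij, hi, hj⟩
  have hset : ∀ σ : Equiv.Perm (Fin n), {F : Fin n → List V |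
      (∀ i, IsDPath Edg (A (σ i)) (E i) (F i)) ∧ ∀ i j, i ≠ j → ∀ v ∈ F i, v ∉ F j} =
      ↑((fam σ).filter fun F => ¬ (crossings F).Nonempty) := fun σ => by
    ext F
    rw [Finset.mem_coe, Finset.mem_filter, hfam, ← hdisj, Set.mem_ofPred_eq]
  have hentry : ∀ u v, {p : List V | IsDPath Edg u v p} = ↑(P u v) := fun u v => by
    ext p
    simp [hP]
  have hzero := sum_intersecting_eq_zero w hacyc A E
    (Finset.univ.sigma fun σ => (fam σ).filter fun F => (crossings F).Nonempty)
    (fun x => by simp [hfam])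
  rw [Finset.sum_sigma] at hzero
  simp only [hset, hentry, finsum_mem_coe_finset]
  rw [← Matrix.det_transpose, Matrix.det_apply', ← zero_add (∑ σ, _ * _), ← hzero,
    ← Finset.sum_add_distrib]
  refine Finset.sum_congr rfl fun σ _ => ?_
  simp only [Matrix.transpose_apply, Matrix.of_apply]
  rw [Finset.prod_univ_sum, ← Finset.mul_sum, ← mul_add, Finset.sum_filter_add_sum_filter_not]
end

section
/- (MacMahon.) Let d ≥ 1 and let A = (a₁, …, a_d) and E = (e₁, …, e_d) be points of ℤ^d with a₁ ≥ a₂ ≥ ⋯ ≥ a_d and e₁ ≥ e₂ ≥ ⋯ ≥ e_d. Then, as rational numbers, the number of lattice paths from A to E with steps the standard unit vectors of ℤ^d, all of whose points (x₁, …, x_d) satisfy x₁ ≥ x₂ ≥ ⋯ ≥ x_d, equals (Σ_{i=1}^d (e_i − a_i))! · det_{1≤i,j≤d}( 1/(e_i − a_j − i + j)! ), where 1/m! is interpreted as 0 whenever m < 0. -/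
/-- `1/m!` as a rational number, interpreted as `0` whenever `m < 0`. -/
def invFact (m : ℤ) : ℚ := if 0 ≤ m then 1 / (Nat.factorial m.toNat : ℚ) else 0

/-- `m!` as a rational number, interpreted as `0` whenever `m < 0`. -/
def zFact (m : ℤ) : ℚ := if 0 ≤ m then (Nat.factorial m.toNat : ℚ) else 0

/-- Weakly decreasing integer vectors. -/
def IsDominant {d : ℕ} (q : Fin d → ℤ) : Prop := ∀ i j : Fin d, i ≤ j → q j ≤ q i

/-- The lattice paths from `a` to `e` with unit steps that stay in the dominant region. -/
def dominantPaths {d : ℕ} (a e : Fin d → ℤ) : Set (List (Fin d → ℤ)) :=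
  {p | p.head? = some a ∧ p.getLast? = some e ∧
    List.IsChain (fun q q' => ∃ i, q' - q = Pi.single i 1) p ∧ ∀ q ∈ p, IsDominant q}

/-- MacMahon's determinant, without the factorial prefactor. -/
def macMahonDet {d : ℕ} (a e : Fin d → ℤ) : ℚ :=
  Matrix.det (Matrix.of fun i j : Fin d =>
    invFact (e i - a j - ((i : ℕ) : ℤ) + ((j : ℕ) : ℤ)))

theorem invFact_zero : invFact 0 = 1 := by simp [invFact]

theorem invFact_of_neg {m : ℤ} (h : m < 0) : invFact m = 0 := by
  simp [invFact, not_le.mpr h]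

theorem mul_invFact (m : ℤ) : (m : ℚ) * invFact m = invFact (m - 1) := by
  rcases lt_trichotomy m 0 with h | rfl | h
  · rw [invFact_of_neg h, invFact_of_neg (by omega), mul_zero]
  · simp [invFact_of_neg]
  · obtain ⟨k, rfl⟩ : ∃ k : ℕ, m = k + 1 := ⟨(m - 1).toNat, by omega⟩
    have h1 : ((k : ℤ) + 1).toNat = k + 1 := by omega
    have h2 : ((k : ℤ) + 1 - 1).toNat = k := by omega
    have hk : (k.factorial : ℚ) ≠ 0 := by positivity
    have hk' : (k : ℚ) + 1 ≠ 0 := by positivity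
    rw [invFact, invFact, if_pos (by omega), if_pos (by omega), h1, h2, Nat.factorial_succ]
    push_cast
    field_simp

theorem zFact_natCast (n : ℕ) : zFact n = n.factorial := by simp [zFact]

theorem zFact_of_neg {m : ℤ} (h : m < 0) : zFact m = 0 := by
  simp [zFact, not_le.mpr h]

theorem macMahonDet_eq_sum {d : ℕ} (a e : Fin d → ℤ) :
    macMahonDet a e = ∑ σ : Equiv.Perm (Fin d), ((Equiv.Perm.sign σ : ℤ) : ℚ) *
      ∏ i, invFact (e i - a (σ i) - ((i : ℕ) : ℤ) + ((σ i : ℕ) : ℤ)) := by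
  rw [macMahonDet, ← Matrix.det_transpose, Matrix.det_apply']
  rfl

theorem sum_shifted_diff {d : ℕ} (a e : Fin d → ℤ) (σ : Equiv.Perm (Fin d)) :
    ∑ i, (e i - a (σ i) - ((i : ℕ) : ℤ) + ((σ i : ℕ) : ℤ)) = ∑ i, (e i - a i) := by
  simp only [Finset.sum_add_distrib, Finset.sum_sub_distrib]
  rw [Equiv.sum_comp σ a, Equiv.sum_comp σ (fun i : Fin d => ((i : ℕ) : ℤ))]
  ring

theorem sum_mul_prod_invFact {d : ℕ} (m : Fin d → ℤ) :
    ((∑ i, m i : ℤ) : ℚ) * ∏ i, invFact (m i) =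
      ∑ k, ∏ i, invFact (m i - (Pi.single k 1 : Fin d → ℤ) i) := by
  push_cast
  rw [Finset.sum_mul]
  refine Finset.sum_congr rfl fun k _ => ?_
  rw [← Finset.mul_prod_erase _ _ (Finset.mem_univ k),
    ← Finset.mul_prod_erase (a := k) _ _ (Finset.mem_univ k), ← mul_assoc, mul_invFact]
  congr 1
  · simp
  · refine Finset.prod_congr rfl fun i hi => ?_
    rw [Pi.single_eq_of_ne (Finset.ne_of_mem_erase hi), sub_zero]

theorem sum_mul_macMahonDet {d : ℕ} (a e : Fin d → ℤ) :
    ((∑ i, (e i - a i) : ℤ) : ℚ) * macMahonDet a e =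
      ∑ k, macMahonDet a (e - Pi.single k 1) := by
  simp only [macMahonDet_eq_sum]
  rw [Finset.sum_comm, Finset.mul_sum]
  refine Finset.sum_congr rfl fun σ _ => ?_
  rw [← Finset.mul_sum, mul_left_comm, ← sum_shifted_diff a e σ, sum_mul_prod_invFact]
  congr 1
  refine Finset.sum_congr rfl fun k _ => Finset.prod_congr rfl fun i _ => ?_
  congr 1
  simp only [Pi.sub_apply]
  ring

theorem isDominant_of_step {d : ℕ} {q : Fin d → ℤ}
    (h : ∀ i j : Fin d, (j : ℕ) = i + 1 → q j ≤ q i) : IsDominant q := by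
  intro i j hij
  obtain ⟨n, hn⟩ : ∃ n : ℕ, (j : ℕ) = i + n := ⟨j - i, by have : (i : ℕ) ≤ j := hij; omega⟩
  clear hij
  induction n generalizing j with
  | zero => rw [show j = i from Fin.ext (by omega)]
  | succ n ih =>
    have hj := j.isLt
    exact (h ⟨i + n, by omega⟩ j (by simp; omega)).trans (ih ⟨i + n, by omega⟩ rfl)

theorem macMahonDet_eq_zero_of_not_isDominant {d : ℕ} {a e : Fin d → ℤ} (he : IsDominant e)
    {k : Fin d} (hk : ¬ IsDominant (e - Pi.single k 1)) :
    macMahonDet a (e - Pi.single k 1) = 0 := by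
  obtain ⟨i, j, hij, hlt⟩ : ∃ i j : Fin d, (j : ℕ) = i + 1 ∧
      (e - Pi.single k 1 : Fin d → ℤ) i < (e - Pi.single k 1 : Fin d → ℤ) j := by
    contrapose! hk
    exact isDominant_of_step hk
  have hne : i ≠ j := fun h => by rw [h] at hij; omega
  have hle : e j ≤ e i := he i j (by rw [Fin.le_def]; omega)
  refine Matrix.det_zero_of_row_eq hne (funext fun l => ?_)
  simp only [Matrix.of_apply]
  congr 1
  simp only [Pi.sub_apply, Pi.single_apply] at hlt ⊢
  split_ifs at hlt ⊢ <;> omega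

theorem perm_eq_one_of_prod_invFact_ne_zero {d : ℕ} {a e : Fin d → ℤ} (ha : IsDominant a)
    (he : IsDominant e) (hs : ∑ i, (e i - a i) = 0) {σ : Equiv.Perm (Fin d)}
    (h : ∏ i, invFact (e i - a (σ i) - ((i : ℕ) : ℤ) + ((σ i : ℕ) : ℤ)) ≠ 0) :
    σ = 1 ∧ e = a := by
  have hnn : ∀ i, 0 ≤ e i - a (σ i) - ((i : ℕ) : ℤ) + ((σ i : ℕ) : ℤ) := by
    intro i
    by_contra hneg
    exact h (Finset.prod_eq_zero (Finset.mem_univ i) (invFact_of_neg (not_le.mp hneg)))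
  have hz : ∀ i, e i - a (σ i) - ((i : ℕ) : ℤ) + ((σ i : ℕ) : ℤ) = 0 := by
    have := (Finset.sum_eq_zero_iff_of_nonneg fun i _ => hnn i).mp
      ((sum_shifted_diff a e σ).trans hs)
    exact fun i => this i (Finset.mem_univ i)
  have hmono : StrictMono σ := by
    intro i j hij
    by_contra hle
    rw [not_lt] at hle
    have h1 := ha _ _ hle
    have h2 := he _ _ hij.le
    have h3 := hz i
    have h4 := hz j
    have h5 : (i : ℕ) < j := hij
    have h6 : (σ j : ℕ) ≤ σ i := hle
    omega
  have hσ : σ = 1 := by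
    have := Subsingleton.elim (hmono.orderIsoOfSurjective σ σ.surjective) (OrderIso.refl (Fin d))
    ext i
    exact congrArg Fin.val (DFunLike.congr_fun this i)
  subst hσ
  refine ⟨rfl, funext fun i => ?_⟩
  have := hz i
  simp only [Equiv.Perm.one_apply] at this
  omega

theorem macMahonDet_self {d : ℕ} {a : Fin d → ℤ} (ha : IsDominant a) : macMahonDet a a = 1 := by
  rw [macMahonDet_eq_sum, Finset.sum_eq_single 1]
  · simp [invFact_zero]
  · intro σ _ hσ
    by_contra h
    exact hσ (perm_eq_one_of_prod_invFact_ne_zero ha ha (by simp) (right_ne_zero_of_mul h)).1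
  · simp

theorem macMahonDet_eq_zero_of_ne {d : ℕ} {a e : Fin d → ℤ} (ha : IsDominant a)
    (he : IsDominant e) (hs : ∑ i, (e i - a i) = 0) (hne : e ≠ a) : macMahonDet a e = 0 := by
  rw [macMahonDet_eq_sum]
  refine Finset.sum_eq_zero fun σ _ => ?_
  by_contra h
  exact hne (perm_eq_one_of_prod_invFact_ne_zero ha he hs (right_ne_zero_of_mul h)).2

theorem mem_dominantPaths_iff {d : ℕ} {a e : Fin d → ℤ} {p : List (Fin d → ℤ)} :
    p ∈ dominantPaths a e ↔ IsDominant e ∧ ((p = [a] ∧ e = a) ∨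
      ∃ k, ∃ q ∈ dominantPaths a (e - Pi.single k 1), q ++ [e] = p) := by
  constructor
  · rintro ⟨h1, h2, h3, h4⟩
    rcases List.eq_nil_or_concat p with rfl | ⟨q, x, rfl⟩
    · simp at h1
    · simp only [List.concat_eq_append] at *
      obtain rfl : x = e := by simpa using h2
      refine ⟨h4 x (by simp), ?_⟩
      rcases List.eq_nil_or_concat q with rfl | ⟨r, y, rfl⟩
      · left
        obtain rfl : x = a := by simpa using h1
        simp
      · right
        simp only [List.concat_eq_append] at *
        rw [List.isChain_append] at h3
        obtain ⟨k, hk⟩ := h3.2.2 y (by simp) x (by simp)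
        refine ⟨k, r ++ [y], ⟨?_, ?_, h3.1, fun q hq => h4 q (by simp at hq ⊢; tauto)⟩, rfl⟩
        · rw [← h1, List.head?_append_of_ne_nil (r ++ [y]) (by simp)]
        · rw [← hk]; simp
  · rintro ⟨he, ⟨rfl, rfl⟩ | ⟨k, q, ⟨h1, h2, h3, h4⟩, rfl⟩⟩
    · exact ⟨rfl, rfl, by simp, by simpa using he⟩
    · refine ⟨?_, by simp, ?_, ?_⟩
      · rw [List.head?_append, h1]; rfl
      · rw [List.isChain_append]
        refine ⟨h3, by simp, fun x hx y hy => ⟨k, ?_⟩⟩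
        obtain rfl : e = y := by simpa using hy
        rw [h2] at hx
        obtain rfl : e - Pi.single k 1 = x := by simpa using hx
        simp
      · intro x hx
        rcases List.mem_append.mp hx with hx | hx
        · exact h4 x hx
        · rw [List.mem_singleton.mp hx]; exact he

theorem sum_sub_single {d : ℕ} (a e : Fin d → ℤ) (k : Fin d) :
    ∑ i, ((e - Pi.single k 1 : Fin d → ℤ) i - a i) = ∑ i, (e i - a i) - 1 := by
  simp only [Pi.sub_apply, Finset.sum_sub_distrib, Finset.sum_pi_single', Finset.mem_univ, if_true]
  ring

theorem sum_nonneg_of_mem_dominantPaths {d : ℕ} {a : Fin d → ℤ} {p : List (Fin d → ℤ)} :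
    ∀ {e : Fin d → ℤ}, p ∈ dominantPaths a e → 0 ≤ ∑ i, (e i - a i) := by
  induction p using List.reverseRecOn with
  | nil => intro e h; simpa using h.1
  | append_singleton p x ih =>
    intro e h
    rcases (mem_dominantPaths_iff.mp h).2 with ⟨-, rfl⟩ | ⟨k, q, hq, hqp⟩
    · simp
    · obtain rfl := (List.append_inj' hqp rfl).1
      have := ih hq
      rw [sum_sub_single] at this
      omega

theorem exists_finset_dominantPaths {d : ℕ} {a : Fin d → ℤ} (ha : IsDominant a) (n : ℕ) :
    ∀ e : Fin d → ℤ, ∑ i, (e i - a i) = n → IsDominant e →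
      ∃ s : Finset (List (Fin d → ℤ)), (s : Set (List (Fin d → ℤ))) = dominantPaths a e ∧
        (s.card : ℚ) = n.factorial * macMahonDet a e := by
  classical
  induction n with
  | zero =>
    intro e hs he
    have hmem : ∀ p, p ∈ dominantPaths a e ↔ p = [a] ∧ e = a := by
      intro p
      rw [mem_dominantPaths_iff]
      constructor
      · rintro ⟨-, h | ⟨k, q, hq, -⟩⟩
        · exact h
        · have := sum_nonneg_of_mem_dominantPaths hq
          rw [sum_sub_single, hs] at this
          simp at this
      · exact fun h => ⟨he, Or.inl h⟩
    by_cases hea : e = a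
    · refine ⟨{[a]}, Set.ext fun p => by rw [hmem]; simp [hea], ?_⟩
      rw [hea, macMahonDet_self ha]
      simp
    · refine ⟨∅, Set.ext fun p => by rw [hmem]; simp [hea], ?_⟩
      rw [macMahonDet_eq_zero_of_ne ha he (by simpa using hs) hea]
      simp
  | succ n ih =>
    intro e hs he
    have hk : ∀ k, ∃ s : Finset (List (Fin d → ℤ)),
        (s : Set (List (Fin d → ℤ))) = dominantPaths a (e - Pi.single k 1) ∧
        (s.card : ℚ) = n.factorial * macMahonDet a (e - Pi.single k 1) := by
      intro k
      by_cases hdom : IsDominant (e - Pi.single k 1)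
      · exact ih _ (by rw [sum_sub_single, hs]; push_cast; ring) hdom
      · refine ⟨∅, ?_, ?_⟩
        · symm
          rw [Finset.coe_empty, Set.eq_empty_iff_forall_notMem]
          exact fun p hp => hdom (mem_dominantPaths_iff.mp hp).1
        · rw [macMahonDet_eq_zero_of_not_isDominant he hdom]
          simp
    choose s hs1 hs2 using hk
    have hmem : ∀ k p, p ∈ s k ↔ p ∈ dominantPaths a (e - Pi.single k 1) := fun k p => by
      rw [← hs1 k, Finset.mem_coe]
    have hinj : Function.Injective fun q : List (Fin d → ℤ) => q ++ [e] :=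
      fun q q' h => List.append_cancel_right h
    have hdisj : ((Finset.univ : Finset (Fin d)) : Set (Fin d)).PairwiseDisjoint
        fun k => (s k).image (· ++ [e]) := by
      intro k _ l _ hkl
      refine Finset.disjoint_left.mpr fun p hp hp' => hkl ?_
      obtain ⟨q, hq, rfl⟩ := Finset.mem_image.mp hp
      obtain ⟨q', hq', h⟩ := Finset.mem_image.mp hp'
      obtain rfl := hinj h
      have h3 := ((hmem k _).mp hq).2.1.symm.trans ((hmem l _).mp hq').2.1
      have h4 := congrFun (sub_right_injective (Option.some_injective _ h3)) k
      by_contra hne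
      rw [Pi.single_eq_same, Pi.single_eq_of_ne hne] at h4
      exact one_ne_zero h4
    refine ⟨Finset.univ.biUnion fun k => (s k).image (· ++ [e]), ?_, ?_⟩
    · ext p
      rw [mem_dominantPaths_iff]
      simp only [Finset.mem_coe, Finset.mem_biUnion, Finset.mem_univ, true_and, Finset.mem_image,
        hmem, he]
      refine ⟨Or.inr, ?_⟩
      rintro (⟨-, rfl⟩ | h)
      · simp only [sub_self, Finset.sum_const_zero] at hs
        omega
      · exact h
    · rw [Finset.card_biUnion hdisj]
      simp only [Finset.card_image_of_injective _ hinj]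
      push_cast
      simp only [hs2]
      rw [← Finset.mul_sum, ← sum_mul_macMahonDet, hs, Nat.factorial_succ]
      push_cast
      ring

/-- **MacMahon's determinant formula** for the number of lattice paths in `ℤ^d`, with
standard unit steps, from `a` to `e`, staying in the region `x₁ ≥ x₂ ≥ ⋯ ≥ x_d`. -/
theorem statement18 (d : ℕ) (hd : 1 ≤ d) (a e : Fin d → ℤ)
    (ha : ∀ i j : Fin d, i ≤ j → a j ≤ a i) (he : ∀ i j : Fin d, i ≤ j → e j ≤ e i) :
    (({p : List (Fin d → ℤ) | p.head? = some a ∧ p.getLast? = some e ∧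
        List.Chain' (fun q q' => ∃ i, q' - q = Pi.single i 1) p ∧
        ∀ q ∈ p, ∀ i j : Fin d, i ≤ j → q j ≤ q i}).ncard : ℚ)
      = zFact (∑ i, (e i - a i)) *
          Matrix.det (Matrix.of fun i j : Fin d =>
            invFact (e i - a j - ((i : ℕ) : ℤ) + ((j : ℕ) : ℤ))) := by
  change ((dominantPaths a e).ncard : ℚ) = zFact (∑ i, (e i - a i)) * macMahonDet a e
  rcases lt_or_ge (∑ i, (e i - a i)) 0 with h | h
  · have hempty : dominantPaths a e = ∅ :=
      Set.eq_empty_iff_forall_notMem.mpr fun p hp =>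
        (sum_nonneg_of_mem_dominantPaths hp).not_gt h
    rw [hempty, zFact_of_neg h]
    simp
  · obtain ⟨n, hn⟩ := Int.eq_ofNat_of_zero_le h
    obtain ⟨s, hs, hcard⟩ := exists_finset_dominantPaths ha n e hn he
    rw [← hs, Set.ncard_coe_finset, hn, zFact_natCast, hcard]
end

section
/- Let d ≥ 1, let μ₁, …, μ_d be non-negative integers, and let c₀, c₁, …, c_d be non-negative integers with c₀ ≥ Σ_{i=1}^d μ_i c_i. Then (1 + Σ_{i=0}^d c_i) times the number of lattice paths in ℤ^{d+1} from the origin to (c₀, c₁, …, c_d) with steps the standard unit vectors, all of whose points (x₀, x₁, …, x_d) satisfy x₀ ≥ Σ_{i=1}^d μ_i x_i, equals (c₀ − Σ_{i=1}^d μ_i c_i + 1) times the multinomial coefficient (1 + Σ_{i=0}^d c_i)! / ((c₀+1)! · c₁! ⋯ c_d!). -/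
/-- Reciprocal factorial on `ℤ`, extended by `0` to the negative integers. -/
def invFactorial (k : ℤ) : ℚ := if k < 0 then 0 else (Nat.factorial k.toNat : ℚ)⁻¹

theorem invFactorial_of_neg {k : ℤ} (hk : k < 0) : invFactorial k = 0 := if_pos hk

theorem invFactorial_natCast (k : ℕ) : invFactorial k = (Nat.factorial k : ℚ)⁻¹ := by
  simp [invFactorial]

theorem invFactorial_sub_one (k : ℤ) : invFactorial (k - 1) = k * invFactorial k := by
  obtain hk | hk | hk := lt_trichotomy k 0
  · rw [invFactorial_of_neg hk, invFactorial_of_neg (by lia), mul_zero]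
  · subst hk
    rw [invFactorial_of_neg (by lia), Int.cast_zero, zero_mul]
  · obtain ⟨m, rfl⟩ : ∃ m : ℕ, k = (m + 1 : ℕ) := ⟨(k - 1).toNat, by lia⟩
    rw [invFactorial_natCast, show ((m + 1 : ℕ) : ℤ) - 1 = (m : ℤ) by push_cast; ring,
      invFactorial_natCast, Nat.factorial_succ]
    push_cast
    have : (m : ℚ) + 1 ≠ 0 := by positivity
    field_simp

/-- The lattice paths with standard unit steps from the origin to `E` that stay in the region
`x₀ ≥ μ₁x₁ + ⋯ + μ_d x_d`. -/
def ballotPaths {d : ℕ} (μ : Fin d → ℕ) (E : Fin (d + 1) → ℤ) : Set (List (Fin (d + 1) → ℤ)) :=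
  {p | p.head? = some (fun _ => 0) ∧ p.getLast? = some E ∧
    p.IsChain (fun q q' => ∃ i, q' - q = Pi.single i 1) ∧
    ∀ q ∈ p, (∑ i : Fin d, (μ i : ℤ) * q i.succ) ≤ q 0}

section BallotPaths

variable {d : ℕ} {μ : Fin d → ℕ} {E : Fin (d + 1) → ℤ}

theorem le_of_mem_ballotPaths {p : List (Fin (d + 1) → ℤ)} (hp : p ∈ ballotPaths μ E) :
    ∑ i, (μ i : ℤ) * E i.succ ≤ E 0 :=
  hp.2.2.2 E (List.mem_of_getLast? hp.2.1)

theorem mem_ballotPaths_iff (p : List (Fin (d + 1) → ℤ)) :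
    p ∈ ballotPaths μ E ↔ (p = [0] ∧ E = 0) ∨ ((∑ i, (μ i : ℤ) * E i.succ ≤ E 0) ∧
      ∃ i, ∃ q ∈ ballotPaths μ (E - Pi.single i 1), q ++ [E] = p) := by
  have h0 : (fun _ => 0 : Fin (d + 1) → ℤ) = 0 := rfl
  rcases List.eq_nil_or_concat p with rfl | ⟨q, x, rfl⟩
  · simp [ballotPaths]
  rcases List.eq_nil_or_concat q with rfl | ⟨r, y, rfl⟩
  · constructor
    · rintro ⟨h, h', -, -⟩
      simp_all
    · rintro (⟨h, rfl⟩ | ⟨-, i, q, hq, h⟩)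
      · simp_all [ballotPaths]
      · cases q <;> simp_all [ballotPaths]
  · simp only [List.concat_eq_append]
    constructor
    · rintro ⟨h, h', hc, hm⟩
      obtain rfl : x = E := by simpa using h'
      rw [List.isChain_append] at hc
      obtain ⟨i, hi⟩ := hc.2.2 y (by simp) x (by simp)
      refine Or.inr ⟨hm x (by simp), i, r ++ [y], ⟨?_, ?_, hc.1,
        fun q hq => hm q (List.mem_append_left _ hq)⟩,
        rfl⟩
      · cases r <;> simp_all
      · simp [← hi]
    · rintro (⟨h, -⟩ | ⟨hE, i, q, ⟨h1, h2, h3, h4⟩, h⟩)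
      · cases r <;> simp at h
      · rw [← h]
        refine ⟨by simp [h1], by simp, ?_, ?_⟩
        · rw [List.isChain_append]
          refine ⟨h3, by simp, ?_⟩
          intro a ha b hb
          rw [h2] at ha
          simp only [Option.mem_def, Option.some.injEq, List.head?_cons] at ha hb
          exact ⟨i, by rw [← ha, ← hb]; simp⟩
        · intro a ha
          rw [List.mem_append, List.mem_singleton] at ha
          rcases ha with ha | rfl
          exacts [h4 a ha, hE]

theorem nonneg_of_mem_ballotPaths (p : List (Fin (d + 1) → ℤ)) :
    ∀ E, p ∈ ballotPaths μ E → 0 ≤ E := by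
  induction p using List.reverseRecOn with
  | nil => simp [ballotPaths]
  | append_singleton p x ih =>
    intro E hE
    rcases (mem_ballotPaths_iff _).1 hE with ⟨-, rfl⟩ | ⟨-, i, q, hq, h⟩
    · rfl
    · obtain ⟨rfl, -⟩ := List.append_inj' h rfl
      have h1 : (0 : Fin (d + 1) → ℤ) ≤ Pi.single i 1 := Pi.single_nonneg.2 zero_le_one
      exact (ih _ hq).trans (sub_le_self _ h1)

theorem ballotPaths_zero : ballotPaths μ 0 = {[0]} := by
  ext p
  rw [mem_ballotPaths_iff, Set.mem_singleton_iff]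
  constructor
  · rintro (⟨rfl, -⟩ | ⟨-, i, q, hq, -⟩)
    · rfl
    · have := nonneg_of_mem_ballotPaths q _ hq i
      simp at this
  · exact fun h => Or.inl ⟨h, rfl⟩

theorem ballotPaths_eq_iUnion (hE : ∑ i, (μ i : ℤ) * E i.succ ≤ E 0) (h0 : E ≠ 0) :
    ballotPaths μ E = ⋃ i, (· ++ [E]) '' ballotPaths μ (E - Pi.single i 1) := by
  ext p
  rw [mem_ballotPaths_iff]
  simp [hE, h0]

theorem disjoint_ballotPaths {E' : Fin (d + 1) → ℤ} (h : E ≠ E') :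
    Disjoint (ballotPaths μ E) (ballotPaths μ E') :=
  Set.disjoint_left.2 fun _ hp hp' => h (Option.some.inj (hp.2.1.symm.trans hp'.2.1))

theorem ncard_ballotPaths_eq_sum (hE : ∑ i, (μ i : ℤ) * E i.succ ≤ E 0) (h0 : E ≠ 0)
    (hfin : ∀ i, (ballotPaths μ (E - Pi.single i 1)).Finite) :
    (ballotPaths μ E).ncard = ∑ i, (ballotPaths μ (E - Pi.single i 1)).ncard := by
  have hinj : Function.Injective (· ++ [E]) := List.append_left_injective [E]
  rw [ballotPaths_eq_iUnion hE h0, Set.ncard_iUnion_of_finite (fun i => (hfin i).image _),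
    finsum_eq_sum_of_fintype]
  · exact Finset.sum_congr rfl fun i _ => Set.ncard_image_of_injective _ hinj
  · intro i j hij
    refine (Set.disjoint_image_iff hinj).2 (disjoint_ballotPaths fun h => hij ?_)
    have h' : (Pi.single i 1 : Fin (d + 1) → ℤ) = Pi.single j 1 := sub_right_injective h
    by_contra hne
    simpa [hne] using congrFun h' i

/-- The ballot-type count of `ballotPaths μ E`, as a function on all of `ℤ^{d+1}`. -/
def ballotCount (μ : Fin d → ℕ) (E : Fin (d + 1) → ℤ) : ℚ :=
  (E 0 - ∑ i, (μ i : ℚ) * E i.succ + 1) * Nat.factorial (∑ i, E i).toNat *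
    (invFactorial (E 0 + 1) * ∏ i : Fin d, invFactorial (E i.succ))

theorem prod_invFactorial_sub_single (x : Fin d → ℤ) (i : Fin d) :
    ∏ j, invFactorial (x j - (Pi.single i 1 : Fin d → ℤ) j) = x i * ∏ j, invFactorial (x j) := by
  rw [← Finset.mul_prod_erase _ _ (Finset.mem_univ i),
    ← Finset.mul_prod_erase _ (fun j => invFactorial (x j)) (Finset.mem_univ i),
    Pi.single_eq_same, invFactorial_sub_one, mul_assoc]
  congr 2
  refine Finset.prod_congr rfl fun j hj => ?_
  rw [Pi.single_eq_of_ne (Finset.ne_of_mem_erase hj), sub_zero]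

theorem ballotCount_eq_sum (hpos : 0 < ∑ i, E i) :
    ballotCount μ E = ∑ i, ballotCount μ (E - Pi.single i 1) := by
  obtain ⟨n, hn⟩ : ∃ n : ℕ, ∑ i, E i = n + 1 := ⟨(∑ i, E i - 1).toNat, by lia⟩
  have hsum (i) : (∑ j, (E - Pi.single i 1 : Fin (d + 1) → ℤ) j).toNat = n := by
    simp [Finset.sum_sub_distrib, hn]
  have hsum' : (∑ j, E j).toNat = n + 1 := by lia
  have hzero : ballotCount μ (E - Pi.single 0 1) =
      (E 0 - ∑ i, (μ i : ℚ) * E i.succ) * Nat.factorial n *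
        ((E 0 + 1) * (invFactorial (E 0 + 1) * ∏ i : Fin d, invFactorial (E i.succ))) := by
    have := invFactorial_sub_one (E 0 + 1)
    rw [ballotCount, hsum]
    simp only [Pi.sub_apply, Pi.single_eq_same, ne_eq, Fin.succ_ne_zero, not_false_eq_true,
      Pi.single_eq_of_ne, sub_zero, sub_add_cancel]
    rw [add_sub_cancel_right] at this
    rw [this]
    push_cast
    ring
  have hsucc (i : Fin d) : ballotCount μ (E - Pi.single i.succ 1) =
      (E 0 - ∑ i, (μ i : ℚ) * E i.succ + 1 + μ i) * Nat.factorial n *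
        (E i.succ * (invFactorial (E 0 + 1) * ∏ i : Fin d, invFactorial (E i.succ))) := by
    have hs (j : Fin d) : (Pi.single i.succ 1 : Fin (d + 1) → ℤ) j.succ =
        (Pi.single i 1 : Fin d → ℤ) j := by
      simp [Pi.single_apply]
    have hμ : ∑ j, (μ j : ℚ) * ((Pi.single i 1 : Fin d → ℤ) j : ℚ) = μ i := by
      simp [Pi.single_apply]
    rw [ballotCount, hsum]
    simp only [Pi.sub_apply, hs, ne_eq, (Fin.succ_ne_zero i).symm, not_false_eq_true,
      Pi.single_eq_of_ne, sub_zero, Int.cast_sub, mul_sub, Finset.sum_sub_distrib, hμ]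
    rw [prod_invFactorial_sub_single (fun j => E j.succ)]
    ring
  rw [Fin.sum_univ_succ, hzero, Finset.sum_congr rfl fun i _ => hsucc i]
  have hE : ∑ i : Fin d, (E i.succ : ℚ) = n + 1 - E 0 := by
    rw [Fin.sum_univ_succ] at hn
    have : (E 0 : ℚ) + ∑ i : Fin d, (E i.succ : ℚ) = n + 1 := by exact_mod_cast hn
    linarith
  set C := invFactorial (E 0 + 1) * ∏ i : Fin d, invFactorial (E i.succ) with hC
  set S := ∑ i, (μ i : ℚ) * E i.succ with hS
  have key : ∑ i : Fin d, ((E 0 : ℚ) - S + 1 + μ i) * Nat.factorial n * (E i.succ * C) =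
      ((E 0 - S + 1) * (n + 1 - E 0) + S) * Nat.factorial n * C := by
    rw [← hE, hS, Finset.mul_sum, ← hS, ← Finset.sum_add_distrib, Finset.sum_mul, Finset.sum_mul]
    exact Finset.sum_congr rfl fun i _ => by ring
  rw [key, ballotCount, hsum', ← hC, ← hS, Nat.factorial_succ]
  push_cast
  ring

theorem ncard_ballotPaths (hE : ∑ i, (μ i : ℤ) * E i.succ ≤ E 0 + 1) :
    (ballotPaths μ E).Finite ∧ ((ballotPaths μ E).ncard : ℚ) = ballotCount μ E := by
  induction hm : (∑ i, E i).toNat using Nat.strong_induction_on generalizing E with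
  | _ m ih =>
  by_cases hneg : ∃ i : Fin d, E i.succ < 0
  · obtain ⟨i, hi⟩ := hneg
    have hempty : ballotPaths μ E = ∅ := Set.eq_empty_of_forall_notMem fun p hp =>
      (nonneg_of_mem_ballotPaths p E hp i.succ).not_gt hi
    rw [hempty, ballotCount,
      Finset.prod_eq_zero (Finset.mem_univ i) (invFactorial_of_neg hi)]
    simp
  push Not at hneg
  obtain hbd | hlt := hE.eq_or_lt
  · have hempty : ballotPaths μ E = ∅ := Set.eq_empty_of_forall_notMem fun p hp => by
      have := le_of_mem_ballotPaths hp
      lia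
    have hbd' : ∑ i, (μ i : ℚ) * E i.succ = E 0 + 1 := by exact_mod_cast hbd
    rw [hempty, ballotCount, hbd']
    simp
  have hle : ∑ i, (μ i : ℤ) * E i.succ ≤ E 0 := by lia
  have hE0 : 0 ≤ E 0 :=
    (Finset.sum_nonneg fun i _ => mul_nonneg (Int.natCast_nonneg _) (hneg i)).trans hle
  have hnn : 0 ≤ E := fun i => Fin.cases hE0 hneg i
  by_cases h0 : E = 0
  · subst h0
    simp [ballotPaths_zero, ballotCount, invFactorial]
  have hpos : 0 < ∑ i, E i := by
    obtain ⟨i, hi⟩ := Function.ne_iff.1 h0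
    exact Finset.sum_pos' (fun i _ => hnn i)
      ⟨i, Finset.mem_univ i, lt_of_le_of_ne (hnn i) (Ne.symm hi)⟩
  have hstep (i : Fin (d + 1)) := by
    refine ih (∑ j, (E - Pi.single i 1 : Fin (d + 1) → ℤ) j).toNat ?_ (E := E - Pi.single i 1) ?_ rfl
    · simp only [Pi.sub_apply, Finset.sum_sub_distrib, Finset.sum_pi_single', Finset.mem_univ,
        if_true]
      lia
    · cases i using Fin.cases with
      | zero => simpa using hle
      | succ i =>
        refine le_trans (Finset.sum_le_sum fun j _ => mul_le_mul_of_nonneg_left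
          (sub_le_self _ ?_) (Int.natCast_nonneg _)) (hE.trans_eq ?_)
        · exact (Pi.single_nonneg.2 zero_le_one : (0 : Fin (d + 1) → ℤ) ≤ Pi.single i.succ 1) _
        · simp
  refine ⟨?_, ?_⟩
  · rw [ballotPaths_eq_iUnion hle h0]
    exact Set.finite_iUnion fun i => (hstep i).1.image _
  · rw [ncard_ballotPaths_eq_sum hle h0 fun i => (hstep i).1, Nat.cast_sum,
      ballotCount_eq_sum hpos]
    exact Finset.sum_congr rfl fun i _ => (hstep i).2

end BallotPaths

/-- Lattice paths in `ℤ^{d+1}` (coordinates `x₀, x₁, …, x_d`), with standard unit steps,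
from the origin to `(c₀, c₁, …, c_d)`, all of whose points satisfy
`x₀ ≥ μ₁x₁ + ⋯ + μ_d x_d`, counted by the formula
`(1 + Σcᵢ) · N = (c₀ − Σμᵢcᵢ + 1) · (1 + Σcᵢ)! / ((c₀+1)!·c₁!⋯c_d!)`. -/
theorem statement19 (d : ℕ) (hd : 1 ≤ d) (μ : Fin d → ℕ) (c₀ : ℕ) (c : Fin d → ℕ)
    (hc : ∑ i, μ i * c i ≤ c₀) :
    ((1 + c₀ + ∑ i, c i : ℚ)) *
        (({p : List (Fin (d + 1) → ℤ) |
            p.head? = some (fun _ => 0) ∧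
            p.getLast? = some (Fin.cases ((c₀ : ℤ)) (fun i => ((c i : ℤ))) : Fin (d + 1) → ℤ) ∧
            List.Chain' (fun q q' => ∃ i, q' - q = Pi.single i 1) p ∧
            ∀ q ∈ p, (∑ i : Fin d, (μ i : ℤ) * q i.succ) ≤ q 0}).ncard : ℚ)
      = ((c₀ : ℚ) - (∑ i, (μ i : ℚ) * (c i : ℚ)) + 1) *
          (Nat.factorial (1 + c₀ + ∑ i, c i) : ℚ)
            / ((Nat.factorial (c₀ + 1) : ℚ) * ∏ i, (Nat.factorial (c i) : ℚ)) := by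
  have h := (ncard_ballotPaths (μ := μ)
    (E := (Fin.cases (c₀ : ℤ) (fun i => (c i : ℤ)) : Fin (d + 1) → ℤ))
    (by simpa using (by exact_mod_cast hc.trans (Nat.le_succ _)))).2
  have hsum : (c₀ + ∑ i, (c i : ℤ)).toNat = c₀ + ∑ i, c i := by
    rw [← Nat.cast_sum, ← Nat.cast_add, Int.toNat_natCast]
  have hfac : Nat.factorial (1 + c₀ + ∑ i, c i) =
      (1 + c₀ + ∑ i, c i) * Nat.factorial (c₀ + ∑ i, c i) := by
    rw [add_assoc, add_comm 1, Nat.factorial_succ]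
  simp only [ballotCount, Fin.sum_univ_succ, Fin.cases_zero, Fin.cases_succ, Int.cast_natCast,
    invFactorial_natCast, hsum, Finset.prod_inv_distrib] at h
  rw [← Nat.cast_succ, invFactorial_natCast] at h
  refine (congrArg _ h).trans ?_
  rw [hfac]
  push_cast
  field_simp
end
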